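/- arXiv:2009.04897 — 3 statements merged into one kernel-verified Lean document; each statement's English description precedes it below -/
import Mathlib

section
/- Let G be a closed connected subgroup of GL(n,ℝ) that is stable under matrix transpose and whose centre is compact. Then every continuous finite-dimensional complex representation ρ : G → GL(V) admits an admissible Hermitian inner product, i.e. a Hermitian inner product ⟨·,·⟩ on V such that ⟨ρ(g)u, v⟩ = ⟨u, ρ(gᵀ)v⟩ for all g ∈ G and all u, v ∈ V. -/
open scoped ComplexConjugate
open Matrix

section ClosedSubgroup

open Filter Topology NormedSpace

variable {𝔸 : Type*} [NormedRing 𝔸] [NormedAlgebra ℝ 𝔸] [CompleteSpace 𝔸]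

theorem exp_add_of_commute_real {x y : 𝔸} (h : Commute x y) : exp (x + y) = exp x * exp y :=
  let _ : NormedAlgebra ℚ 𝔸 := .restrictScalars ℚ ℝ 𝔸
  exp_add_of_commute h

theorem exp_mul_exp_neg_real (x : 𝔸) : exp x * exp (-x) = 1 := by
  rw [← exp_add_of_commute_real ((Commute.refl x).neg_right), add_neg_cancel, exp_zero]

theorem exp_continuous_real : Continuous (exp : 𝔸 → 𝔸) :=
  let _ : NormedAlgebra ℚ 𝔸 := .restrictScalars ℚ ℝ 𝔸
  exp_continuous

/-- The exponential of an element of a Banach algebra, as a unit. -/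
noncomputable def expUnit (x : 𝔸) : 𝔸ˣ where
  val := exp x
  inv := exp (-x)
  val_inv := exp_mul_exp_neg_real x
  inv_val := by simpa using exp_mul_exp_neg_real (-x)

@[simp]
theorem coe_expUnit (x : 𝔸) : (expUnit x : 𝔸) = exp x := rfl

theorem coe_expUnit_inv (x : 𝔸) : ((expUnit x)⁻¹ : 𝔸ˣ) = exp (-x) := rfl

theorem continuous_expUnit : Continuous (expUnit : 𝔸 → 𝔸ˣ) :=
  Units.isOpenEmbedding_val.isEmbedding.continuous_iff.mpr exp_continuous_real

theorem expUnit_zero : expUnit (0 : 𝔸) = 1 := Units.ext exp_zero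

theorem expUnit_add_of_commute {x y : 𝔸} (h : Commute x y) :
    expUnit (x + y) = expUnit x * expUnit y :=
  Units.ext (exp_add_of_commute_real h)

theorem expUnit_neg (x : 𝔸) : expUnit (-x) = (expUnit x)⁻¹ := Units.ext rfl

theorem expUnit_nsmul (n : ℕ) (x : 𝔸) : expUnit (n • x) = expUnit x ^ n := by
  induction n with
  | zero => simp [expUnit_zero]
  | succ k ih =>
    rw [succ_nsmul, expUnit_add_of_commute ((Commute.refl x).smul_left k), ih, pow_succ]

theorem expUnit_zsmul (n : ℤ) (x : 𝔸) : expUnit (n • x) = expUnit x ^ n := by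
  obtain ⟨k, rfl | rfl⟩ := n.eq_nat_or_neg
  · rw [natCast_zsmul, zpow_natCast, expUnit_nsmul]
  · rw [neg_smul, natCast_zsmul, expUnit_neg, expUnit_nsmul, _root_.zpow_neg, zpow_natCast]

theorem expUnit_conj (u : 𝔸ˣ) (x : 𝔸) : expUnit (u * x * ↑u⁻¹) = u * expUnit x * u⁻¹ :=
  let _ : NormedAlgebra ℚ 𝔸 := .restrictScalars ℚ ℝ 𝔸
  Units.ext (exp_units_conj u x)

/-- A limit of rescaled logarithms of small elements of a closed subgroup generates a
one-parameter subgroup of it. -/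
theorem expUnit_smul_mem_of_tendsto {Γ : Subgroup 𝔸ˣ} (hΓ : IsClosed (Γ : Set 𝔸ˣ))
    {α : Type*} {l : Filter α} [l.NeBot] {y : α → 𝔸} {s : α → ℝ} {z : 𝔸}
    (hy : Tendsto y l (𝓝 0)) (hs : Tendsto (fun a => s a • y a) l (𝓝 z))
    (hmem : ∀ᶠ a in l, expUnit (y a) ∈ Γ) (t : ℝ) : expUnit (t • z) ∈ Γ := by
  have hfract : Tendsto (fun a => Int.fract (t * s a) • y a) l (𝓝 0) := by
    refine squeeze_zero_norm (fun a => ?_) (tendsto_zero_iff_norm_tendsto_zero.mp hy)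
    rw [norm_smul, Real.norm_of_nonneg (Int.fract_nonneg _)]
    exact mul_le_of_le_one_left (norm_nonneg _) (Int.fract_lt_one _).le
  have hfloor : Tendsto (fun a => ⌊t * s a⌋ • y a) l (𝓝 (t • z)) := by
    have h := (hs.const_smul t).sub hfract
    rw [sub_zero] at h
    refine h.congr fun a => ?_
    rw [smul_smul, ← sub_smul, Int.self_sub_fract, Int.cast_smul_eq_zsmul]
  refine hΓ.mem_of_tendsto ((continuous_expUnit.tendsto _).comp hfloor) ?_
  filter_upwards [hmem] with a ha
  rw [Function.comp_apply, expUnit_zsmul]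
  exact Γ.zpow_mem ha _

theorem hasStrictFDerivAt_exp_zero_real :
    HasStrictFDerivAt (exp : 𝔸 → 𝔸) ((ContinuousLinearEquiv.refl ℝ 𝔸 : 𝔸 ≃L[ℝ] 𝔸) : 𝔸 →L[ℝ] 𝔸) 0 :=
  hasStrictFDerivAt_exp_zero

theorem hasDerivAt_exp_smul_real (x : 𝔸) (t : ℝ) :
    HasDerivAt (fun s : ℝ => exp (s • x)) (exp (t • x) * x) t :=
  hasDerivAt_exp_smul_const x t

theorem expUnit_smul_add_mem {Γ : Subgroup 𝔸ˣ} (hΓ : IsClosed (Γ : Set 𝔸ˣ)) {x z : 𝔸}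
    (hx : ∀ t : ℝ, expUnit (t • x) ∈ Γ) (hz : ∀ t : ℝ, expUnit (t • z) ∈ Γ) (t : ℝ) :
    expUnit (t • (x + z)) ∈ Γ := by
  have hexp := hasStrictFDerivAt_exp_zero_real (𝔸 := 𝔸)
  set log := hexp.localInverse exp _ 0 with hlog
  have hF : HasDerivAt (fun t : ℝ => exp (t • x) * exp (t • z)) (x + z) 0 := by
    simpa using (hasDerivAt_exp_smul_real x 0).fun_mul (hasDerivAt_exp_smul_real z 0)
  have hlog_deriv : HasFDerivAt log (ContinuousLinearMap.id ℝ 𝔸)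
      (exp ((0 : ℝ) • x) * exp ((0 : ℝ) • z)) := by
    have h := hexp.to_localInverse.hasFDerivAt
    simpa using h
  have hlog_exp : ∀ᶠ a in 𝓝 (1 : 𝔸), exp (log a) = a := by
    simpa using hexp.eventually_right_inverse
  have hlog_one : log 1 = 0 := by
    simpa using hexp.localInverse_apply_image
  have hF0 : Tendsto (fun t : ℝ => exp (t • x) * exp (t • z)) (𝓝 0) (𝓝 1) := by
    simpa using hF.continuousAt.tendsto
  have hcomp := hlog_deriv.comp_hasDerivAt (0 : ℝ) hF
  refine expUnit_smul_mem_of_tendsto hΓ (l := 𝓝[≠] (0 : ℝ))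
    (y := fun t => log (exp (t • x) * exp (t • z))) (s := fun t => t⁻¹) ?_ ?_ ?_ t
  · have h := hcomp.continuousAt.tendsto
    simp only [Function.comp_def, zero_smul, exp_zero, mul_one, hlog_one] at h
    exact h.mono_left nhdsWithin_le_nhds
  · have h := hasDerivAt_iff_tendsto_slope.mp hcomp
    refine (h.congr fun t => ?_)
    simp [slope, hlog_one]
  · filter_upwards [nhdsWithin_le_nhds (hF0.eventually hlog_exp)] with t ht
    have : expUnit (log (exp (t • x) * exp (t • z))) = expUnit (t • x) * expUnit (t • z) :=
      Units.ext ht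
    rw [this]
    exact Γ.mul_mem (hx t) (hz t)

/-- The Lie algebra of a closed subgroup of the unit group of a Banach algebra. -/
def lieSubmodule (Γ : Subgroup 𝔸ˣ) (hΓ : IsClosed (Γ : Set 𝔸ˣ)) : Submodule ℝ 𝔸 where
  carrier := {x | ∀ t : ℝ, expUnit (t • x) ∈ Γ}
  zero_mem' t := by simp [expUnit_zero, Γ.one_mem]
  add_mem' hx hz := expUnit_smul_add_mem hΓ hx hz
  smul_mem' c x hx t := by simpa [smul_smul] using hx (t * c)

theorem mem_lieSubmodule {Γ : Subgroup 𝔸ˣ} {hΓ : IsClosed (Γ : Set 𝔸ˣ)} {x : 𝔸} :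
    x ∈ lieSubmodule Γ hΓ ↔ ∀ t : ℝ, expUnit (t • x) ∈ Γ := Iff.rfl

theorem conj_mem_lieSubmodule {Γ : Subgroup 𝔸ˣ} {hΓ : IsClosed (Γ : Set 𝔸ˣ)} {u : 𝔸ˣ}
    (hu : u ∈ Γ) {x : 𝔸} (hx : x ∈ lieSubmodule Γ hΓ) :
    (u * x * ↑u⁻¹ : 𝔸) ∈ lieSubmodule Γ hΓ := fun t => by
  have h : t • (u * x * ↑u⁻¹ : 𝔸) = u * (t • x) * ↑u⁻¹ := by simp
  rw [h, expUnit_conj]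
  exact Γ.mul_mem (Γ.mul_mem hu (hx t)) (Γ.inv_mem hu)

theorem commutator_mem_lieSubmodule [FiniteDimensional ℝ 𝔸] {Γ : Subgroup 𝔸ˣ}
    {hΓ : IsClosed (Γ : Set 𝔸ˣ)} {x y : 𝔸} (hx : x ∈ lieSubmodule Γ hΓ)
    (hy : y ∈ lieSubmodule Γ hΓ) : x * y - y * x ∈ lieSubmodule Γ hΓ := by
  have hF : HasDerivAt (fun t : ℝ => exp (t • x) * y * exp (t • -x)) (x * y - y * x) 0 := by
    have h :=
      ((hasDerivAt_exp_smul_real x 0).mul_const y).fun_mul (hasDerivAt_exp_smul_real (-x) 0)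
    rw [sub_eq_add_neg]
    simpa using h
  have hlim := hasDerivAt_iff_tendsto_slope.mp hF
  refine (Submodule.closed_of_finiteDimensional (lieSubmodule Γ hΓ)).mem_of_tendsto hlim
    (Eventually.of_forall fun t => ?_)
  refine Submodule.smul_mem _ _ (Submodule.sub_mem _ ?_ (by simpa using hy))
  simpa [coe_expUnit_inv] using conj_mem_lieSubmodule (hx t) hy

/-- Small nonzero elements of a complement of the Lie algebra exponentiate outside a closed
subgroup. -/
theorem eventually_eq_zero_of_expUnit_mem [FiniteDimensional ℝ 𝔸] {Γ : Subgroup 𝔸ˣ}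
    (hΓ : IsClosed (Γ : Set 𝔸ˣ)) {m : Submodule ℝ 𝔸} (hm : Disjoint (lieSubmodule Γ hΓ) m) :
    ∀ᶠ y : m in 𝓝 0, expUnit (y : 𝔸) ∈ Γ → y = 0 := by
  by_contra hcon
  rw [not_eventually] at hcon
  let S : Set m := {y | ¬(expUnit (y : 𝔸) ∈ Γ → y = 0)}
  have hne : (𝓝 (0 : m) ⊓ 𝓟 S).NeBot := frequently_mem_iff_neBot.mp hcon
  set l : Ultrafilter m := Ultrafilter.of (𝓝 (0 : m) ⊓ 𝓟 S)
  have hl : (l : Filter m) ≤ 𝓝 0 ⊓ 𝓟 S := Ultrafilter.of_le _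
  have hlS : ∀ᶠ y in (l : Filter m), y ∈ S := hl.trans inf_le_right (mem_principal_self S)
  have hS : ∀ y ∈ S, expUnit (y : 𝔸) ∈ Γ ∧ y ≠ 0 := fun y hy => by
    simpa [S] using hy
  have hsphere : ∀ᶠ y in (l : Filter m), ‖y‖⁻¹ • y ∈ Metric.sphere (0 : m) 1 := by
    filter_upwards [hlS] with y hy
    have : ‖y‖ ≠ 0 := norm_ne_zero_iff.mpr (hS y hy).2
    rw [mem_sphere_zero_iff_norm, norm_smul, norm_inv, norm_norm, inv_mul_cancel₀ this]
  obtain ⟨z, hz, hlz⟩ := (isCompact_sphere (0 : m) 1).ultrafilter_le_nhds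
    (l.map fun y => ‖y‖⁻¹ • y) (le_principal_iff.mpr hsphere)
  have hzmem : (z : 𝔸) ∈ lieSubmodule Γ hΓ := by
    refine expUnit_smul_mem_of_tendsto hΓ (l := (l : Filter m)) (y := fun y => (y : 𝔸))
      (s := fun y => ‖y‖⁻¹) ?_ ?_ ?_
    · have h : Tendsto (fun y : m => (y : 𝔸)) (𝓝 0) (𝓝 0) :=
        continuous_subtype_val.tendsto' _ _ rfl
      exact h.mono_left (hl.trans inf_le_left)
    · exact (continuous_subtype_val.tendsto z).comp (show Tendsto _ (l : Filter m) _ from hlz)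
    · filter_upwards [hlS] with y hy using (hS y hy).1
  have hz0 : z = 0 := Subtype.ext (Submodule.disjoint_def.mp hm z hzmem z.2)
  simp [hz0] at hz

/-- Elements of a closed subgroup near the identity are exponentials of elements of its Lie
algebra. -/
theorem eventually_mem_exists_expUnit [FiniteDimensional ℝ 𝔸] {Γ : Subgroup 𝔸ˣ}
    (hΓ : IsClosed (Γ : Set 𝔸ˣ)) :
    ∀ᶠ u in 𝓝 (1 : 𝔸ˣ), u ∈ Γ → ∃ x ∈ lieSubmodule Γ hΓ, u = expUnit x := by
  obtain ⟨m, hm⟩ := Submodule.exists_isCompl (lieSubmodule Γ hΓ)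
  let e := (Submodule.prodEquivOfIsCompl _ _ hm).toContinuousLinearEquiv
  let φ : lieSubmodule Γ hΓ × m → 𝔸 := fun p => exp (p.1 : 𝔸) * exp (p.2 : 𝔸)
  have hφ : HasStrictFDerivAt φ (e : (lieSubmodule Γ hΓ × m) →L[ℝ] 𝔸) 0 := by
    have h1 : HasStrictFDerivAt (fun p : lieSubmodule Γ hΓ × m => exp (p.1 : 𝔸)) _ 0 :=
      HasStrictFDerivAt.comp (0 : lieSubmodule Γ hΓ × m)
        (g := exp) (f := ((lieSubmodule Γ hΓ).subtypeL.comp (ContinuousLinearMap.fst ℝ _ m)))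
        (by simpa using hasStrictFDerivAt_exp_zero_real (𝔸 := 𝔸))
        (ContinuousLinearMap.hasStrictFDerivAt _)
    have h2 : HasStrictFDerivAt (fun p : lieSubmodule Γ hΓ × m => exp (p.2 : 𝔸)) _ 0 :=
      HasStrictFDerivAt.comp (0 : lieSubmodule Γ hΓ × m)
        (g := exp) (f := (m.subtypeL.comp (ContinuousLinearMap.snd ℝ _ m)))
        (by simpa using hasStrictFDerivAt_exp_zero_real (𝔸 := 𝔸))
        (ContinuousLinearMap.hasStrictFDerivAt _)
    refine (h1.mul' h2).congr_fderiv ?_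
    ext p <;> simp [e]
  have hmap : map φ (𝓝 0) = 𝓝 1 := by
    have h := hφ.map_nhds_eq_of_equiv
    simpa [φ] using h
  have hsnd : ∀ᶠ p : lieSubmodule Γ hΓ × m in 𝓝 0, expUnit (p.2 : 𝔸) ∈ Γ → p.2 = 0 :=
    (continuous_snd.tendsto' (0 : lieSubmodule Γ hΓ × m) 0 rfl).eventually
      (eventually_eq_zero_of_expUnit_mem hΓ hm.disjoint)
  have hval : ∀ᶠ a in 𝓝 (1 : 𝔸),
      ∀ u : 𝔸ˣ, (u : 𝔸) = a → u ∈ Γ → ∃ x ∈ lieSubmodule Γ hΓ, u = expUnit x := by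
    rw [← hmap, eventually_map]
    filter_upwards [hsnd] with p hp u hu huΓ
    have hu' : u = expUnit (p.1 : 𝔸) * expUnit (p.2 : 𝔸) := Units.ext hu
    have h1 : expUnit (p.1 : 𝔸) ∈ Γ := by simpa using p.1.2 1
    have h2 : p.2 = 0 := hp ((Γ.mul_mem_cancel_left h1).mp (hu' ▸ huΓ))
    exact ⟨p.1, p.1.2, by simp [hu', h2, expUnit_zero]⟩
  filter_upwards [(Units.continuous_val.tendsto' 1 1 rfl).eventually hval] with u hu
  exact hu u rfl

end ClosedSubgroup

section Bochner

variable {ι M : Type*} [Fintype ι] [AddCommGroup M] [Module ℝ M]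

/-- An algebraic Bochner formula: for totally antisymmetric structure constants `c` and
skew operators `L`, a divergence-free one-cocycle `f` with nonnegative curvature term
vanishes on commutators and is invariant. -/
theorem bochner_vanishing (q : M →ₗ[ℝ] M →ₗ[ℝ] ℝ) (hsymm : ∀ x y, q x y = q y x)
    (hpos : ∀ x, x ≠ 0 → 0 < q x x) (c : ι → ι → ι → ℝ) (hanti : ∀ i j k, c j i k = -c i j k)
    (hcyc : ∀ i j k, c j k i = c i j k) (L : ι → M →ₗ[ℝ] M)
    (hL : ∀ i x y, q (L i x) y = -q x (L i y)) (f : ι → M) (hdiv : ∑ i, L i (f i) = 0)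
    (hcoc : ∀ i j, L i (f j) - L j (f i) = ∑ k, c i j k • f k)
    (hcurv : 0 ≤ ∑ i, ∑ j,
      q (f j) (L i (L j (f i)) - L j (L i (f i)) - ∑ k, c i j k • L k (f i))) (i j : ι) :
    ∑ k, c i j k • f k = 0 ∧ L i (f j) = 0 := by
  have hnonneg : ∀ x, 0 ≤ q x x := fun x => by
    by_cases hx : x = 0
    · simp [hx]
    · exact (hpos x hx).le
  have hzero : ∀ x, q x x = 0 → x = 0 := fun x hx => by
    by_contra h
    exact (hpos x h).ne' hx
  set h : ι → ι → M := fun i j => ∑ k, c i j k • f k with hh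
  have hhanti : ∀ i j, h j i = -h i j := fun i j => by simp [hh, hanti i j]
  set D : ι → ι → M := fun i j => L i (f j) - (1 / 2 : ℝ) • h i j with hD
  have hDsymm : ∀ i j, D j i = D i j := fun i j => by
    have h1 : L i (f j) = L j (f i) + h i j := by
      rw [hh, ← sub_eq_iff_eq_add', hcoc i j]
    simp only [hD, h1, hhanti i j]
    module
  have hexpand : ∀ i j, q (D i j) (D i j) = q (L i (f j)) (L j (f i))
      + 1 / 2 * q (h i j) (L i (f j)) + 1 / 2 * q (h j i) (L j (f i))
      - 1 / 4 * q (h i j) (h i j) := fun i j => by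
    nth_rw 2 [← hDsymm i j]
    simp only [hD, hhanti i j, map_sub, map_smul, map_neg, LinearMap.sub_apply,
      LinearMap.smul_apply, LinearMap.neg_apply, smul_eq_mul, hsymm _ (h i j)]
    ring
  have hP : ∑ i, ∑ j, q (h j i) (L j (f i)) = ∑ i, ∑ j, q (h i j) (L i (f j)) :=
    Finset.sum_comm
  have hG : ∑ i, ∑ j, q (L i (f j)) (L j (f i)) + ∑ i, ∑ j, q (h i j) (L i (f j)) ≤ 0 := by
    have hsplit : ∀ i j, q (L i (f j)) (L j (f i)) =
        -q (f j) (L i (L j (f i)) - L j (L i (f i)) - ∑ k, c i j k • L k (f i))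
        - q (f j) (L j (L i (f i))) - ∑ k, c i j k * q (f j) (L k (f i)) := fun i j => by
      rw [hL]
      simp only [map_sub, map_sum, map_smul, smul_eq_mul]
      ring
    have hmid : ∑ i, ∑ j, q (f j) (L j (L i (f i))) = 0 := by
      rw [Finset.sum_comm]
      refine Finset.sum_eq_zero fun j _ => ?_
      rw [← map_sum, ← map_sum, hdiv]
      simp
    have hthird : ∑ i, ∑ j, ∑ k, c i j k * q (f j) (L k (f i))
        = ∑ i, ∑ j, q (h i j) (L i (f j)) := by
      calc ∑ i, ∑ j, ∑ k, c i j k * q (f j) (L k (f i))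
          = ∑ i, ∑ k, ∑ j, c i j k * q (f j) (L k (f i)) :=
            Finset.sum_congr rfl fun i _ => Finset.sum_comm
        _ = ∑ k, ∑ i, ∑ j, c i j k * q (f j) (L k (f i)) := Finset.sum_comm
        _ = ∑ i, ∑ j, q (h i j) (L i (f j)) := by
            refine Finset.sum_congr rfl fun i _ => Finset.sum_congr rfl fun j _ => ?_
            simp only [hh, map_sum, map_smul, LinearMap.sum_apply, LinearMap.smul_apply,
              smul_eq_mul, hcyc]
    simp only [hsplit, Finset.sum_sub_distrib, Finset.sum_neg_distrib, hmid, hthird]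
    linarith
  have htotal : ∑ i, ∑ j, (q (D i j) (D i j) + 1 / 4 * q (h i j) (h i j)) ≤ 0 := by
    have : ∑ i, ∑ j, (q (D i j) (D i j) + 1 / 4 * q (h i j) (h i j))
        = ∑ i, ∑ j, q (L i (f j)) (L j (f i)) + ∑ i, ∑ j, q (h i j) (L i (f j)) := by
      simp only [hexpand, sub_add_cancel, Finset.sum_add_distrib, ← Finset.mul_sum, hP]
      ring
    rw [this]
    exact hG
  have hterm : ∀ i j, 0 ≤ q (D i j) (D i j) + 1 / 4 * q (h i j) (h i j) := fun i j => by
    have := hnonneg (D i j)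
    have := hnonneg (h i j)
    positivity
  have hij : q (D i j) (D i j) + 1 / 4 * q (h i j) (h i j) ≤ 0 :=
    ((Finset.single_le_sum (f := fun j => q (D i j) (D i j) + 1 / 4 * q (h i j) (h i j))
      (fun j _ => hterm i j) (Finset.mem_univ j)).trans
      (Finset.single_le_sum (f := fun i => ∑ j, (q (D i j) (D i j) + 1 / 4 * q (h i j) (h i j)))
        (fun i _ => Finset.sum_nonneg fun j _ => hterm i j) (Finset.mem_univ i))).trans htotal
  have hh0 : h i j = 0 := hzero _ (by linarith [hnonneg (D i j), hnonneg (h i j)])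
  have hD0 : D i j = 0 := hzero _ (by linarith [hnonneg (D i j), hnonneg (h i j)])
  refine ⟨hh0, ?_⟩
  simpa [hD, hh0] using hD0

/-- A family that vanishes on commutators and on central combinations is zero. -/
theorem eq_zero_of_commutator_of_central (q : M →ₗ[ℝ] M →ₗ[ℝ] ℝ)
    (hpos : ∀ x, x ≠ 0 → 0 < q x x) (c : ι → ι → ι → ℝ) (f : ι → M)
    (hcomm : ∀ i j, ∑ k, c i j k • f k = 0)
    (hcentral : ∀ x : ι → ℝ, (∀ i j, ∑ k, c i j k * x k = 0) → ∑ k, x k • f k = 0) (l : ι) :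
    f l = 0 := by
  by_contra hl
  have h := congrArg (q (f l)) (hcentral (fun k => q (f l) (f k)) fun i j => by
    simpa using congrArg (q (f l)) (hcomm i j))
  simp only [map_sum, map_smul, smul_eq_mul, map_zero] at h
  have := (Finset.sum_eq_zero_iff_of_nonneg fun k _ => mul_self_nonneg (q (f l) (f k))).mp h l
    (Finset.mem_univ l)
  exact (hpos _ hl).ne' (mul_self_eq_zero.mp this)

/-- Every family can be made divergence-free by subtracting a coboundary. -/
theorem exists_sum_apply_sub_eq_zero [FiniteDimensional ℝ M] (q : M →ₗ[ℝ] M →ₗ[ℝ] ℝ)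
    (hsymm : ∀ x y, q x y = q y x) (hpos : ∀ x, x ≠ 0 → 0 < q x x) (L : ι → M →ₗ[ℝ] M)
    (hL : ∀ i x y, q (L i x) y = -q x (L i y)) (f : ι → M) :
    ∃ T, ∑ i, L i (f i - L i T) = 0 := by
  set Δ : M →ₗ[ℝ] M := ∑ i, L i ∘ₗ L i
  have hΔ : ∀ x, Δ x = ∑ i, L i (L i x) := fun x => by simp [Δ]
  have hzero : ∀ x, q x x = 0 → x = 0 := fun x hx => by
    by_contra h
    exact (hpos x h).ne' hx
  have hcompl := (LinearMap.BilinForm.isCompl_orthogonal_iff_disjoint (B := q)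
    (W := LinearMap.range Δ) fun x y h => by rw [hsymm, h]).mpr
      (Submodule.disjoint_def.mpr fun x hx hx' => hzero x (hx' x hx))
  obtain ⟨y, hy, w, hw, hyw⟩ := Submodule.mem_sup.mp
    (hcompl.sup_eq_top ▸ Submodule.mem_top (x := ∑ i, L i (f i)))
  obtain ⟨T, rfl⟩ := hy
  have horth : ∀ x, q (Δ x) w = 0 := fun x =>
    LinearMap.BilinForm.mem_orthogonal_iff.mp hw _ ⟨x, rfl⟩
  have hLw : ∀ i, L i w = 0 := by
    have h : ∑ i, q (L i w) (L i w) = 0 := by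
      have := horth w
      simpa [hΔ, hL] using this
    intro i
    refine hzero _ ((Finset.sum_eq_zero_iff_of_nonneg fun k _ => ?_).mp h i (Finset.mem_univ i))
    by_cases hx : L k w = 0
    · simp [hx]
    · exact (hpos _ hx).le
  have hw0 : w = 0 := by
    refine hzero _ ?_
    have h : q (∑ i, L i (f i)) w = 0 := by simp [hL, hLw]
    rw [← hyw] at h
    simpa [horth] using h
  refine ⟨T, ?_⟩
  simp only [map_sub, Finset.sum_sub_distrib, ← hΔ, ← hyw, hw0]
  simp

end Bochner

section FrobeniusForm

variable {m n : Type*} [Fintype m] [Fintype n]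

/-- The real inner product `Re tr(Aᴴ B)` on complex matrices. -/
noncomputable def frobForm : Matrix m n ℂ →ₗ[ℝ] Matrix m n ℂ →ₗ[ℝ] ℝ :=
  LinearMap.mk₂ ℝ (fun A B => (Aᴴ * B).trace.re)
    (fun A B C => by simp [Matrix.add_mul])
    (fun r A B => by simp)
    (fun A B C => by simp [Matrix.mul_add])
    (fun r A B => by simp)

theorem frobForm_apply (A B : Matrix m n ℂ) : frobForm A B = (Aᴴ * B).trace.re := rfl

theorem frobForm_symm (A B : Matrix m n ℂ) : frobForm A B = frobForm B A := by
  rw [frobForm_apply, frobForm_apply, ← Complex.conj_re, starRingEnd_apply,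
    ← Matrix.trace_conjTranspose]
  simp

theorem frobForm_self (A : Matrix m n ℂ) : frobForm A A = ∑ i, ∑ j, ‖A i j‖ ^ 2 := by
  rw [frobForm_apply, Matrix.trace, Finset.sum_comm, Complex.re_sum]
  refine Finset.sum_congr rfl fun j _ => ?_
  rw [Matrix.diag_apply, Matrix.mul_apply, Complex.re_sum]
  refine Finset.sum_congr rfl fun i _ => ?_
  rw [Matrix.conjTranspose_apply, Complex.star_def, ← Complex.normSq_eq_conj_mul_self,
    Complex.ofReal_re, Complex.normSq_eq_norm_sq]

theorem frobForm_pos (A : Matrix m n ℂ) (hA : A ≠ 0) : 0 < frobForm A A := by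
  rw [frobForm_self]
  have hnn : ∀ i, 0 ≤ ∑ j, ‖A i j‖ ^ 2 := fun i => Finset.sum_nonneg fun j _ => sq_nonneg _
  refine (Finset.sum_nonneg fun i _ => hnn i).lt_of_ne' fun h => hA ?_
  ext i j
  have h1 := (Finset.sum_eq_zero_iff_of_nonneg fun i _ => hnn i).mp h i (Finset.mem_univ i)
  have h2 := (Finset.sum_eq_zero_iff_of_nonneg fun j _ => sq_nonneg _).mp h1 j (Finset.mem_univ j)
  simpa using h2

theorem frobForm_mul_left (S : Matrix m m ℂ) (A B : Matrix m n ℂ) :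
    frobForm (S * A) B = frobForm A (Sᴴ * B) := by
  simp [frobForm_apply, Matrix.mul_assoc]

theorem frobForm_mul_right (S : Matrix n n ℂ) (A B : Matrix m n ℂ) :
    frobForm (A * S) B = frobForm A (B * Sᴴ) := by
  rw [frobForm_apply, frobForm_apply, Matrix.conjTranspose_mul, Matrix.mul_assoc,
    Matrix.trace_mul_comm, Matrix.mul_assoc]

end FrobeniusForm

section MinimalVector

theorem conjTranspose_sum_smul {ι κ : Type*} [Fintype ι] (x : ι → ℝ) (B : ι → Matrix κ κ ℂ) :
    (∑ k, x k • B k)ᴴ = ∑ k, x k • (B k)ᴴ := by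
  simp [Matrix.conjTranspose_sum]

theorem sum_form_commutator_eq_zero_of_forall_conj_le {ι 𝔸 : Type*} [Fintype ι] [NormedRing 𝔸]
    [NormedAlgebra ℝ 𝔸] [FiniteDimensional ℝ 𝔸] (q : 𝔸 →ₗ[ℝ] 𝔸 →ₗ[ℝ] ℝ) (B : ι → 𝔸) (Y : 𝔸)
    (hmin : ∀ t : ℝ, ∑ i, q (B i) (B i) ≤
      ∑ i, q (NormedSpace.exp (t • Y) * B i * NormedSpace.exp (-(t • Y)))
        (NormedSpace.exp (t • Y) * B i * NormedSpace.exp (-(t • Y)))) :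
    ∑ i, (q (Y * B i - B i * Y) (B i) + q (B i) (Y * B i - B i * Y)) = 0 := by
  have : CompleteSpace 𝔸 := FiniteDimensional.complete ℝ 𝔸
  let b : ι → ℝ → 𝔸 := fun i t => NormedSpace.exp (t • Y) * B i * NormedSpace.exp (t • -Y)
  have hb : ∀ i, HasDerivAt (b i) (Y * B i - B i * Y) 0 := fun i => by
    have h := ((hasDerivAt_exp_smul_real Y 0).mul_const (B i)).fun_mul
      (hasDerivAt_exp_smul_real (-Y) 0)
    rw [sub_eq_add_neg]
    simpa [b] using h
  have hb0 : ∀ i, b i 0 = B i := fun i => by simp [b]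
  obtain ⟨Q, hQ⟩ : ∃ Q : 𝔸 →L[ℝ] 𝔸 →L[ℝ] ℝ, ∀ A C, Q A C = q A C :=
    ⟨q.toContinuousBilinearMap, fun _ _ => rfl⟩
  have hderiv : HasDerivAt (fun t => ∑ i, Q (b i t) (b i t))
      (∑ i, (Q (Y * B i - B i * Y) (B i) + Q (B i) (Y * B i - B i * Y))) 0 := by
    refine HasDerivAt.fun_sum fun i _ => ?_
    have h := HasDerivAt.clm_apply (Q.hasFDerivAt.comp_hasDerivAt (0 : ℝ) (hb i)) (hb i)
    simpa only [hb0, Function.comp_apply] using h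
  have hloc : IsLocalMin (fun t => ∑ i, Q (b i t) (b i t)) 0 := by
    refine Filter.Eventually.of_forall fun t => ?_
    simp only [hb0, hQ]
    simpa [b] using hmin t
  simpa only [hQ] using hloc.hasDerivAt_eq_zero hderiv

/-- Among all `B'` intertwined with `B` by a nonzero `T`, there is one of least norm. -/
theorem exists_intertwiner_norm_minimal {ι 𝔸 : Type*} [Fintype ι] [NormedRing 𝔸] [Nontrivial 𝔸]
    [NormedAlgebra ℝ 𝔸] [FiniteDimensional ℝ 𝔸] (B : ι → 𝔸) :
    ∃ (T : 𝔸) (B' : ι → 𝔸), T ≠ 0 ∧ (∀ i, T * B i = B' i * T) ∧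
      ∀ (S : 𝔸) (C : ι → 𝔸), S ≠ 0 → (∀ i, S * B i = C i * S) →
        ∑ i, ‖B' i‖ ^ 2 ≤ ∑ i, ‖C i‖ ^ 2 := by
  let E : (ι → 𝔸) → ℝ := fun B' => ∑ i, ‖B' i‖ ^ 2
  have hE : Continuous E := by fun_prop
  let K : Set (𝔸 × (ι → 𝔸)) :=
    {p | ‖p.1‖ = 1 ∧ E p.2 ≤ E B ∧ (fun i => p.1 * B i) = fun i => p.2 i * p.1}
  have hscale : ∀ (T : 𝔸) (B' : ι → 𝔸), T ≠ 0 → E B' ≤ E B →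
      (∀ i, T * B i = B' i * T) → (‖T‖⁻¹ • T, B') ∈ K := fun T B' hT hB' hTB => by
    refine ⟨?_, hB', funext fun i => ?_⟩
    · rw [norm_smul, norm_inv, norm_norm, inv_mul_cancel₀ (norm_ne_zero_iff.mpr hT)]
    · rw [smul_mul_assoc, hTB, mul_smul_comm]
  have hKne : K.Nonempty := ⟨_, hscale 1 B one_ne_zero le_rfl fun i => by simp⟩
  have hKcompact : IsCompact K := by
    have : ProperSpace (𝔸 × (ι → 𝔸)) := FiniteDimensional.proper ℝ _
    refine Metric.isCompact_of_isClosed_isBounded ?_ ?_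
    · refine (isClosed_eq continuous_fst.norm continuous_const).inter
        ((isClosed_le (hE.comp continuous_snd) continuous_const).inter (isClosed_eq ?_ ?_))
      · exact continuous_pi fun i => continuous_fst.mul continuous_const
      · exact continuous_pi fun i => ((continuous_apply i).comp continuous_snd).mul continuous_fst
    · refine (Metric.isBounded_closedBall (x := 0) (r := 1 + E B)).subset fun p hp => ?_
      have hEB : 0 ≤ E B := Finset.sum_nonneg fun i _ => sq_nonneg _
      rw [mem_closedBall_zero_iff, Prod.norm_def, max_le_iff]
      refine ⟨by linarith [hp.1], (pi_norm_le_iff_of_nonneg (by linarith)).mpr fun i => ?_⟩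
      have h1 : ‖p.2 i‖ ^ 2 ≤ E p.2 :=
        Finset.single_le_sum (f := fun i => ‖p.2 i‖ ^ 2) (fun i _ => sq_nonneg _)
          (Finset.mem_univ i)
      nlinarith [hp.2.1, sq_nonneg (‖p.2 i‖ - 1)]
  obtain ⟨⟨T, B'⟩, ⟨hT1, hB'E, hTB⟩, hmin⟩ :=
    hKcompact.exists_isMinOn hKne (hE.comp continuous_snd).continuousOn
  refine ⟨T, B', fun h => by simp [h] at hT1, congrFun hTB, fun S C hS hSC => ?_⟩
  by_cases hle : E C ≤ E B
  · exact isMinOn_iff.mp hmin _ (hscale S C hS hle hSC)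
  · exact hB'E.trans (not_le.mp hle).le

variable {ι κ : Type*} [Fintype ι] [Fintype κ]

/-- A representation of a compact Lie algebra whose moment map vanishes is skew-Hermitian, as
soon as its centre acts by skew-Hermitian matrices. -/
theorem conjTranspose_eq_neg_of_moment_eq_zero (c : ι → ι → ι → ℝ)
    (hanti : ∀ i j k, c j i k = -c i j k) (hcyc : ∀ i j k, c j k i = c i j k)
    (B : ι → Matrix κ κ ℂ) (hbr : ∀ i j, B i * B j - B j * B i = ∑ k, c i j k • B k)
    (hmoment : ∑ i, (B i * (B i)ᴴ - (B i)ᴴ * B i) = 0)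
    (hcentral : ∀ x : ι → ℝ, (∀ i j, ∑ k, c i j k * x k = 0) →
      (∑ k, x k • B k)ᴴ = -∑ k, x k • B k) (i : ι) : (B i)ᴴ = -B i := by
  let f : ι → Matrix κ κ ℂ := fun i => B i + (B i)ᴴ
  let L : ι → Matrix κ κ ℂ →ₗ[ℝ] Matrix κ κ ℂ := fun i =>
    LinearMap.mulLeft ℝ (B i - (B i)ᴴ) - LinearMap.mulRight ℝ (B i - (B i)ᴴ)
  have hLapp : ∀ i X, L i X = (B i - (B i)ᴴ) * X - X * (B i - (B i)ᴴ) := fun i X => rfl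
  have hbr' : ∀ i j, (B j)ᴴ * (B i)ᴴ - (B i)ᴴ * (B j)ᴴ = ∑ k, c i j k • (B k)ᴴ := fun i j => by
    rw [← conjTranspose_sum_smul, ← hbr]
    simp
  have hf : ∀ i, (f i)ᴴ = f i := fun i => by simp [f, add_comm]
  have hS : ∀ i, (B i - (B i)ᴴ)ᴴ = -(B i - (B i)ᴴ) := fun i => by simp
  have hbochner := bochner_vanishing (M := Matrix κ κ ℂ) frobForm frobForm_symm frobForm_pos
    (fun i j k => 2 * c i j k) (fun i j k => by simp [hanti i j k])
    (fun i j k => by simp [hcyc i j k]) L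
    (fun i X Y => by
      rw [hLapp, hLapp, map_sub, LinearMap.sub_apply, frobForm_mul_left, frobForm_mul_right, hS]
      simp only [Matrix.neg_mul, Matrix.mul_neg, map_neg, map_sub]
      ring)
    f
    (by
      have : ∀ i, L i (f i) = (2 : ℝ) • (B i * (B i)ᴴ - (B i)ᴴ * B i) := fun i => by
        rw [hLapp, two_smul]
        simp only [f]
        noncomm_ring
      simp only [this, ← Finset.smul_sum, hmoment, smul_zero])
    (fun i j => by
      simp only [f, smul_add, mul_smul, Finset.sum_add_distrib, ← hbr, ← hbr',
        hLapp, two_smul]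
      noncomm_ring)
    (by
      refine Finset.sum_nonneg fun i _ => Finset.sum_nonneg fun j _ => ?_
      set C := f i * f j - f j * f i with hC
      have hterm : L i (L j (f i)) - L j (L i (f i)) - ∑ k, (2 * c i j k) • L k (f i)
          = f i * C - C * f i := by
        have hsum : ∑ k, (2 * c i j k) • L k (f i)
            = (2 : ℝ) • (((B i * B j - B j * B i) - ((B j)ᴴ * (B i)ᴴ - (B i)ᴴ * (B j)ᴴ)) * f i
              - f i * ((B i * B j - B j * B i) - ((B j)ᴴ * (B i)ᴴ - (B i)ᴴ * (B j)ᴴ))) := by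
          rw [hbr, hbr', ← Finset.sum_sub_distrib, Finset.sum_mul, Finset.mul_sum,
            ← Finset.sum_sub_distrib, Finset.smul_sum]
          refine Finset.sum_congr rfl fun k _ => ?_
          rw [hLapp, mul_smul, ← smul_sub, smul_mul_assoc, mul_smul_comm, ← smul_sub]
        rw [hsum, two_smul]
        simp only [hLapp, hC, f]
        noncomm_ring
      have h1 : frobForm (f j) (f i * C) = frobForm (f i * f j) C := by
        rw [frobForm_mul_left, hf]
      have h2 : frobForm (f j) (C * f i) = frobForm (f j * f i) C := by
        rw [frobForm_mul_right, hf]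
      rw [hterm, map_sub, h1, h2, ← LinearMap.sub_apply, ← map_sub, ← hC]
      by_cases h0 : C = 0
      · simp [h0]
      · exact (frobForm_pos C h0).le)
  have hfi : f i = 0 := eq_zero_of_commutator_of_central frobForm frobForm_pos
    (fun i j k => 2 * c i j k) f (fun i j => (hbochner i j).1) (fun x hx => by
      have := hcentral x fun i j => by simpa [mul_assoc, ← Finset.mul_sum] using hx i j
      simp only [f, smul_add, Finset.sum_add_distrib]
      rw [← conjTranspose_sum_smul, this, add_neg_cancel]) i
  exact eq_neg_of_add_eq_zero_right hfi

variable [DecidableEq κ]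

open scoped Matrix.Norms.Frobenius

theorem frobForm_self_eq_norm_sq (A : Matrix κ κ ℂ) : frobForm A A = ‖A‖ ^ 2 := by
  rw [frobForm_self, Matrix.frobenius_norm_def, ← Real.sqrt_eq_rpow, Real.sq_sqrt]
  · simp
  · positivity

/-- A tuple of matrices of least Frobenius norm in its conjugacy class has vanishing
moment map. -/
theorem moment_eq_zero_of_forall_conj_le (B : ι → Matrix κ κ ℂ)
    (hmin : ∀ g g' : Matrix κ κ ℂ, g * g' = 1 → ∑ i, frobForm (B i) (B i) ≤
      ∑ i, frobForm (g * B i * g') (g * B i * g')) :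
    ∑ i, (B i * (B i)ᴴ - (B i)ᴴ * B i) = 0 := by
  set Y := ∑ i, (B i * (B i)ᴴ - (B i)ᴴ * B i) with hY
  have h0 := sum_form_commutator_eq_zero_of_forall_conj_le frobForm B Y fun t =>
    hmin _ _ (exp_mul_exp_neg_real (t • Y))
  have hterm : ∀ i, frobForm (Y * B i - B i * Y) (B i) + frobForm (B i) (Y * B i - B i * Y)
      = 2 * frobForm Y (B i * (B i)ᴴ - (B i)ᴴ * B i) := fun i => by
    rw [frobForm_symm (B i), ← two_mul, map_sub, LinearMap.sub_apply,
      frobForm_mul_right, frobForm_mul_left, map_sub]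
  by_contra hne
  simp only [hterm, ← Finset.mul_sum, ← map_sum, ← hY] at h0
  exact (frobForm_pos Y hne).ne' (by linarith)

/-- An irreducible tuple of matrices has a conjugate with vanishing moment map. -/
theorem exists_conj_moment_eq_zero [Nonempty κ] (B : ι → Matrix κ κ ℂ)
    (hirr : ∀ (T : Matrix κ κ ℂ) (B' : ι → Matrix κ κ ℂ), T ≠ 0 →
      (∀ i, T * B i = B' i * T) → IsUnit T) :
    ∃ g g' : Matrix κ κ ℂ, g * g' = 1 ∧
      ∑ i, ((g * B i * g') * (g * B i * g')ᴴ - (g * B i * g')ᴴ * (g * B i * g')) = 0 := by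
  obtain ⟨T, B', hT0, hTB, hmin⟩ := exists_intertwiner_norm_minimal B
  obtain ⟨T', hTT', -⟩ := isUnit_iff_exists.mp (hirr T B' hT0 hTB)
  have hconj : ∀ i, T * B i * T' = B' i := fun i => by
    rw [hTB i, Matrix.mul_assoc, hTT', Matrix.mul_one]
  refine ⟨T, T', hTT', ?_⟩
  simp only [hconj]
  refine moment_eq_zero_of_forall_conj_le B' fun h h' hh => ?_
  have hh' : h' * h = 1 := mul_eq_one_comm.mp hh
  simp only [frobForm_self_eq_norm_sq]
  refine hmin (h * T) (fun i => h * B' i * h') (fun h0 => hT0 ?_) fun i => ?_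
  · rw [← Matrix.one_mul T, ← hh', Matrix.mul_assoc, h0, Matrix.mul_zero]
  · rw [Matrix.mul_assoc, hTB i, Matrix.mul_assoc (h * B' i), ← Matrix.mul_assoc h' h, hh',
      Matrix.one_mul, Matrix.mul_assoc]

end MinimalVector

section ImaginarySemisimple

open Polynomial

/-- `A` is semisimple with purely imaginary spectrum: it is annihilated by a separable polynomial
all of whose roots are purely imaginary. -/
def IsImaginarySemisimple {R : Type*} [Ring R] [Algebra ℂ R] (A : R) : Prop :=
  ∃ p : ℂ[X], IsCoprime p (derivative p) ∧ aeval A p = 0 ∧ ∀ z, p.IsRoot z → z.re = 0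

theorem IsImaginarySemisimple.map {R S : Type*} [Ring R] [Algebra ℂ R] [Ring S] [Algebra ℂ S]
    {A : R} (hA : IsImaginarySemisimple A) (φ : R →ₐ[ℂ] S) : IsImaginarySemisimple (φ A) := by
  obtain ⟨p, hp, hpA, hroot⟩ := hA
  exact ⟨p, hp, by rw [aeval_algHom_apply, hpA, map_zero], hroot⟩

theorem aeval_mul_eq_mul_aeval {R : Type*} [Ring R] [Algebra ℂ R] {A A' S : R}
    (h : A * S = S * A') (p : ℂ[X]) : aeval A p * S = S * aeval A' p := by
  induction p using Polynomial.induction_on with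
  | C a => simp [Algebra.commutes]
  | add p q hp hq => simp only [map_add, add_mul, mul_add, hp, hq]
  | monomial n a hn =>
    rw [pow_succ, ← mul_assoc, map_mul, aeval_X, map_mul (aeval A'), aeval_X, mul_assoc, h,
      ← mul_assoc, hn, mul_assoc]

theorem IsImaginarySemisimple.conj {R : Type*} [Ring R] [Algebra ℂ R] {A A' S : R}
    (hA : IsImaginarySemisimple A) (hS : IsUnit S) (h : A * S = S * A') :
    IsImaginarySemisimple A' := by
  obtain ⟨p, hp, hpA, hroot⟩ := hA
  refine ⟨p, hp, ?_, hroot⟩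
  rw [← hS.mul_right_inj, ← aeval_mul_eq_mul_aeval h, hpA, zero_mul, mul_zero]

theorem comp_aeval_eq_aeval_comp {V W : Type*} [AddCommGroup V] [Module ℂ V] [AddCommGroup W]
    [Module ℂ W] {A : Module.End ℂ V} {A' : Module.End ℂ W} {S : V →ₗ[ℂ] W}
    (h : S ∘ₗ A = A' ∘ₗ S) (p : ℂ[X]) : S ∘ₗ aeval A p = aeval A' p ∘ₗ S := by
  induction p using Polynomial.induction_on with
  | C a => ext; simp
  | add p q hp hq => simp only [map_add, LinearMap.comp_add, LinearMap.add_comp, hp, hq]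
  | monomial n a hn =>
    rw [pow_succ, ← mul_assoc, map_mul, aeval_X, map_mul (aeval A'), aeval_X,
      Module.End.mul_eq_comp, Module.End.mul_eq_comp, ← LinearMap.comp_assoc, hn,
      LinearMap.comp_assoc, h, LinearMap.comp_assoc]

theorem IsImaginarySemisimple.of_injective {V W : Type*} [AddCommGroup V] [Module ℂ V]
    [AddCommGroup W] [Module ℂ W] {A : Module.End ℂ V} {A' : Module.End ℂ W} {S : V →ₗ[ℂ] W}
    (hA' : IsImaginarySemisimple A') (hS : Function.Injective S) (h : S ∘ₗ A = A' ∘ₗ S) :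
    IsImaginarySemisimple A := by
  obtain ⟨p, hp, hpA, hroot⟩ := hA'
  refine ⟨p, hp, LinearMap.ext fun v => hS ?_, hroot⟩
  simpa [hpA] using LinearMap.congr_fun (comp_aeval_eq_aeval_comp h p) v

theorem IsImaginarySemisimple.of_surjective {V W : Type*} [AddCommGroup V] [Module ℂ V]
    [AddCommGroup W] [Module ℂ W] {A : Module.End ℂ V} {A' : Module.End ℂ W} {S : V →ₗ[ℂ] W}
    (hA : IsImaginarySemisimple A) (hS : Function.Surjective S) (h : S ∘ₗ A = A' ∘ₗ S) :
    IsImaginarySemisimple A' := by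
  obtain ⟨p, hp, hpA, hroot⟩ := hA
  refine ⟨p, hp, LinearMap.ext fun w => ?_, hroot⟩
  obtain ⟨v, rfl⟩ := hS w
  simpa [hpA] using (LinearMap.congr_fun (comp_aeval_eq_aeval_comp h p) v).symm

variable {m n : Type*} [Fintype m] [Fintype n] [DecidableEq m] [DecidableEq n]

theorem aeval_fromBlocks_zero₂₁ {a : Matrix m m ℂ} {f : Matrix m n ℂ} {d : Matrix n n ℂ}
    (h : a * f = f * d) (p : ℂ[X]) :
    aeval (fromBlocks a f 0 d) p
      = fromBlocks (aeval a p) (aeval a (derivative p) * f) 0 (aeval d p) := by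
  induction p using Polynomial.induction_on with
  | C r =>
    simp only [aeval_C, Matrix.algebraMap_eq_diagonal, derivative_C, map_zero, Matrix.zero_mul]
    rw [fromBlocks_diagonal]
    congr 1
    ext i
    cases i <;> rfl
  | add p q hp hq =>
    simp only [map_add, hp, hq, fromBlocks_add, Matrix.add_mul, add_zero]
  | monomial k r hk =>
    rw [pow_succ, ← mul_assoc, map_mul, hk, aeval_X, fromBlocks_multiply,
      derivative_mul (f := C r * X ^ k), derivative_X, mul_one]
    simp only [map_mul, map_add, aeval_X, Matrix.mul_zero, Matrix.zero_mul, add_zero, zero_add,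
      Matrix.add_mul, Matrix.mul_assoc, h]
    rw [add_comm]

theorem eq_zero_of_isImaginarySemisimple_fromBlocks {a : Matrix m m ℂ} {f : Matrix m n ℂ}
    {d : Matrix n n ℂ} (h : a * f = f * d) (hs : IsImaginarySemisimple (fromBlocks a f 0 d)) :
    f = 0 := by
  obtain ⟨p, ⟨u, v, huv⟩, hp, -⟩ := hs
  rw [aeval_fromBlocks_zero₂₁ h, ← fromBlocks_zero, fromBlocks_inj] at hp
  have h1 := congrArg (fun r => aeval a r * f) huv
  simpa [Matrix.add_mul, Matrix.mul_assoc, hp.1, hp.2.1] using h1.symm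

end ImaginarySemisimple

section Extension

variable {ι m n : Type*} [Fintype ι] [Fintype m] [Fintype n] [DecidableEq m] [DecidableEq n]

/-- An extension of two skew-Hermitian representations of a compact Lie algebra splits, provided
the centre acts semisimply. -/
theorem exists_splitting_of_conjTranspose_eq_neg (c : ι → ι → ι → ℝ)
    (hanti : ∀ i j k, c j i k = -c i j k) (hcyc : ∀ i j k, c j k i = c i j k)
    (a : ι → Matrix m m ℂ) (f : ι → Matrix m n ℂ) (d : ι → Matrix n n ℂ)
    (ha : ∀ i, (a i)ᴴ = -a i) (hd : ∀ i, (d i)ᴴ = -d i)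
    (hbra : ∀ i j, a i * a j - a j * a i = ∑ k, c i j k • a k)
    (hbrd : ∀ i j, d i * d j - d j * d i = ∑ k, c i j k • d k)
    (hbrf : ∀ i j, a i * f j + f i * d j - (a j * f i + f j * d i) = ∑ k, c i j k • f k)
    (hcentral : ∀ x : ι → ℝ, (∀ i j, ∑ k, c i j k * x k = 0) → IsImaginarySemisimple
      (fromBlocks (∑ k, x k • a k) (∑ k, x k • f k) 0 (∑ k, x k • d k))) :
    ∃ T : Matrix m n ℂ, ∀ i, f i = a i * T - T * d i := by
  let L : ι → Matrix m n ℂ →ₗ[ℝ] Matrix m n ℂ := fun i =>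
    mulLeftLinearMap n ℝ (a i) - mulRightLinearMap m ℝ (d i)
  have hLapp : ∀ i X, L i X = a i * X - X * d i := fun i X => rfl
  have hL : ∀ i X Y, frobForm (L i X) Y = -frobForm X (L i Y) := fun i X Y => by
    rw [hLapp, hLapp, map_sub, LinearMap.sub_apply, frobForm_mul_left, frobForm_mul_right, ha, hd]
    simp only [Matrix.neg_mul, Matrix.mul_neg, map_neg, map_sub]
    ring
  have hcurv : ∀ i j X, L i (L j X) - L j (L i X) = ∑ k, c i j k • L k X := fun i j X => by
    have : ∑ k, c i j k • L k X = (∑ k, c i j k • a k) * X - X * ∑ k, c i j k • d k := by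
      simp only [Matrix.sum_mul, Matrix.mul_sum, ← Finset.sum_sub_distrib, hLapp, smul_sub,
        Matrix.smul_mul, Matrix.mul_smul]
    rw [this, ← hbra, ← hbrd]
    simp only [hLapp, Matrix.mul_sub, Matrix.sub_mul, Matrix.mul_assoc]
    abel
  obtain ⟨T, hT⟩ := exists_sum_apply_sub_eq_zero frobForm frobForm_symm frobForm_pos L hL f
  refine ⟨T, fun l => sub_eq_zero.mp ?_⟩
  set F : ι → Matrix m n ℂ := fun i => f i - L i T with hF
  have hbochner := bochner_vanishing frobForm frobForm_symm frobForm_pos c hanti hcyc L hL F hT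
    (fun i j => by
      simp only [hF, smul_sub, Finset.sum_sub_distrib, ← hbrf, ← hcurv, map_sub]
      rw [hLapp i (f j), hLapp j (f i)]
      abel)
    (Finset.sum_nonneg fun i _ => Finset.sum_nonneg fun j _ => by
      rw [hcurv, sub_self, map_zero])
  refine eq_zero_of_commutator_of_central frobForm frobForm_pos c F
    (fun i j => (hbochner i j).1) (fun x hx => ?_) l
  have hLF : (∑ k, x k • a k) * (∑ k, x k • F k) = (∑ k, x k • F k) * ∑ k, x k • d k := by
    rw [← sub_eq_zero]
    have : ∑ i, ∑ j, (x i * x j) • L i (F j) = 0 :=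
      Finset.sum_eq_zero fun i _ => Finset.sum_eq_zero fun j _ => by
        rw [(hbochner i j).2, smul_zero]
    rw [← this]
    simp only [Matrix.sum_mul, Matrix.mul_sum, hLapp, smul_sub, Finset.sum_sub_distrib,
        Matrix.smul_mul, Matrix.mul_smul, Finset.smul_sum, mul_smul]
    congr 1
    rw [Finset.sum_comm]
    exact Finset.sum_congr rfl fun i _ => Finset.sum_congr rfl fun j _ => smul_comm _ _ _
  refine eq_zero_of_isImaginarySemisimple_fromBlocks hLF
    ((hcentral x hx).conj (S := fromBlocks 1 (-T) 0 1) ?_ ?_)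
  · exact isUnit_iff_exists.mpr ⟨fromBlocks 1 T 0 1, by simp [fromBlocks_multiply],
      by simp [fromBlocks_multiply]⟩
  · have : ∑ k, x k • F k
        = (∑ k, x k • f k) - ((∑ k, x k • a k) * T - T * ∑ k, x k • d k) := by
      simp only [hF, hLapp, Matrix.sum_mul, Matrix.mul_sum, smul_sub, Finset.sum_sub_distrib,
        Matrix.smul_mul, Matrix.mul_smul]
    rw [this]
    simp only [fromBlocks_multiply, Matrix.mul_one, Matrix.one_mul, Matrix.mul_zero,
      Matrix.zero_mul, add_zero, zero_add, neg_zero, Matrix.mul_neg, Matrix.neg_mul]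
    congr 1
    abel

end Extension

section CompactLieAlgebra

theorem exists_basis_toMatrix_eq_conj {V κ : Type*} [AddCommGroup V] [Module ℂ V] [Fintype κ]
    [DecidableEq κ] (b : Module.Basis κ ℂ V) {g g' : Matrix κ κ ℂ} (h : g * g' = 1) :
    ∃ b' : Module.Basis κ ℂ V, ∀ A : Module.End ℂ V,
      LinearMap.toMatrixAlgEquiv b' A = g * LinearMap.toMatrixAlgEquiv b A * g' := by
  have h' : g' * g = 1 := mul_eq_one_comm.mp h
  have hcomp : ∀ s t : Matrix κ κ ℂ, s * t = 1 →
      Matrix.toLinAlgEquiv b s ∘ₗ Matrix.toLinAlgEquiv b t = LinearMap.id := fun s t hst => by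
    rw [← Module.End.mul_eq_comp, ← map_mul, hst, map_one, Module.End.one_eq_id]
  refine ⟨b.map (LinearEquiv.ofLinearMap (Matrix.toLinAlgEquiv b g') (Matrix.toLinAlgEquiv b g)
    (hcomp _ _ h') (hcomp _ _ h)), fun A => ?_⟩
  have : LinearMap.toMatrixAlgEquiv b (Matrix.toLinAlgEquiv b g * A * Matrix.toLinAlgEquiv b g')
      = g * LinearMap.toMatrixAlgEquiv b A * g' := by
    rw [map_mul, map_mul, LinearMap.toMatrixAlgEquiv_toLinAlgEquiv,
      LinearMap.toMatrixAlgEquiv_toLinAlgEquiv]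
  rw [← this]
  rfl

theorem toMatrixAlgEquiv_sumQuot {V m n : Type*} [AddCommGroup V] [Module ℂ V] [Fintype m]
    [Fintype n] [DecidableEq m] [DecidableEq n] {W : Submodule ℂ V} (bW : Module.Basis m ℂ W)
    (bQ : Module.Basis n ℂ (V ⧸ W)) (A : Module.End ℂ V) (hA : W ≤ W.comap A) :
    ∃ f : Matrix m n ℂ, LinearMap.toMatrixAlgEquiv (bW.sumQuot bQ) A
      = fromBlocks (LinearMap.toMatrixAlgEquiv bW (A.restrict hA)) f 0
        (LinearMap.toMatrixAlgEquiv bQ (W.mapQ W A hA)) := by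
  refine ⟨(LinearMap.toMatrixAlgEquiv (bW.sumQuot bQ) A).toBlocks₁₂, ?_⟩
  refine (fromBlocks_toBlocks _).symm.trans ?_
  rw [fromBlocks_inj]
  refine ⟨?_, rfl, ?_, ?_⟩
  · ext i j
    simp only [toBlocks₁₁, of_apply, LinearMap.toMatrixAlgEquiv_apply, Module.Basis.sumQuot_inl]
    exact Module.Basis.sumQuot_repr_inl_of_mem bW bQ _ _ i
  · ext i j
    simp only [toBlocks₂₁, of_apply, LinearMap.toMatrixAlgEquiv_apply, Module.Basis.sumQuot_inl]
    exact Module.Basis.sumQuot_repr_inr_of_mem bW bQ _ (hA (bW j).2) i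
  · ext i j
    simp only [toBlocks₂₂, of_apply, LinearMap.toMatrixAlgEquiv_apply,
      Module.Basis.sumQuot_repr_inr]
    rw [← Module.Basis.sumQuot_inr bW bQ j, W.mapQ_apply]
    simp

theorem sum_smul_fromBlocks {ι m n : Type*} [Fintype ι] (x : ι → ℝ) (a : ι → Matrix m m ℂ)
    (f : ι → Matrix m n ℂ) (d : ι → Matrix n n ℂ) :
    ∑ k, x k • fromBlocks (a k) (f k) 0 (d k)
      = fromBlocks (∑ k, x k • a k) (∑ k, x k • f k) 0 (∑ k, x k • d k) := by
  ext (i | i) (j | j) <;> simp [Matrix.sum_apply]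

variable {ι : Type*} [Fintype ι]

theorem map_sum_ofReal_smul {R κ : Type*} [Ring R] [Algebra ℂ R] [Fintype κ] [DecidableEq κ]
    (e : R →ₐ[ℂ] Matrix κ κ ℂ) (x : ι → ℝ) (B : ι → R) :
    e (∑ k, (x k : ℂ) • B k) = ∑ k, x k • e (B k) := by
  simp only [map_sum, map_smul]
  rfl

theorem conjTranspose_real_smul_eq_neg {κ : Type*} [DecidableEq κ] {z : ℂ} (hz : z.re = 0) :
    (z • (1 : Matrix κ κ ℂ))ᴴ = -(z • 1) := by
  have : star z = -z := Complex.ext (by simp [hz]) (by simp)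
  rw [conjTranspose_smul, conjTranspose_one, this, neg_smul]

theorem commute_sum_smul_of_central {V : Type*} [AddCommGroup V] [Module ℂ V]
    {c : ι → ι → ι → ℝ} (hcyc : ∀ i j k, c j k i = c i j k) {B : ι → Module.End ℂ V}
    (hbr : ∀ i j, B i * B j - B j * B i = ∑ k, (c i j k : ℂ) • B k) {x : ι → ℝ}
    (hx : ∀ i j, ∑ k, c i j k * x k = 0) (i : ι) :
    B i * (∑ k, (x k : ℂ) • B k) = (∑ k, (x k : ℂ) • B k) * B i := by
  rw [← sub_eq_zero, Finset.mul_sum, Finset.sum_mul, ← Finset.sum_sub_distrib]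
  simp only [mul_smul_comm, smul_mul_assoc, ← smul_sub, hbr, Finset.smul_sum, smul_smul]
  rw [Finset.sum_comm]
  refine Finset.sum_eq_zero fun l _ => ?_
  rw [← Finset.sum_smul]
  have := hx l i
  have h2 : ∑ k, (x k : ℂ) * (c i k l : ℂ) = 0 := by
    rw [← Complex.ofReal_zero, ← this]
    push_cast
    exact Finset.sum_congr rfl fun k _ => by rw [hcyc l i k, mul_comm]
  rw [h2, zero_smul]

/-- The irreducible case of `exists_basis_conjTranspose_eq_neg`. -/
theorem exists_basis_conjTranspose_eq_neg_of_irreducible {V : Type*} [AddCommGroup V] [Module ℂ V]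
    [FiniteDimensional ℂ V] [Nontrivial V] (c : ι → ι → ι → ℝ)
    (hanti : ∀ i j k, c j i k = -c i j k) (hcyc : ∀ i j k, c j k i = c i j k)
    (B : ι → Module.End ℂ V)
    (hbr : ∀ i j, B i * B j - B j * B i = ∑ k, (c i j k : ℂ) • B k)
    (hcentral : ∀ x : ι → ℝ, (∀ i j, ∑ k, c i j k * x k = 0) →
      IsImaginarySemisimple (∑ k, (x k : ℂ) • B k))
    (hirr : ∀ W : Submodule ℂ V, (∀ i, W ≤ W.comap (B i)) → W = ⊥ ∨ W = ⊤) :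
    ∃ (κ : Type) (_ : Fintype κ) (_ : DecidableEq κ) (b : Module.Basis κ ℂ V),
      ∀ i, (LinearMap.toMatrixAlgEquiv b (B i))ᴴ = -LinearMap.toMatrixAlgEquiv b (B i) := by
  let b := Module.finBasis ℂ V
  let e := LinearMap.toMatrixAlgEquiv b
  have : Nonempty (Fin (Module.finrank ℂ V)) := Fin.pos_iff_nonempty.mp Module.finrank_pos
  obtain ⟨g, g', hg, hmoment⟩ := exists_conj_moment_eq_zero (fun i => e (B i))
    fun T B' hT hTB => by
      obtain ⟨t, rfl⟩ := e.surjective T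
      choose β hβ using fun i => e.surjective (B' i)
      have htB : ∀ i, t * B i = β i * t := fun i => e.injective (by
        rw [map_mul, map_mul, hTB, hβ])
      refine IsUnit.map e ((LinearMap.isUnit_iff_ker_eq_bot t).mpr ?_)
      refine (hirr (LinearMap.ker t) fun i v hv => ?_).resolve_right fun h => hT ?_
      · have := LinearMap.congr_fun (htB i) v
        rw [Module.End.mul_apply, Module.End.mul_apply, LinearMap.mem_ker.mp hv, map_zero] at this
        exact this
      · rw [LinearMap.ker_eq_top.mp h, map_zero]
  obtain ⟨b', hb'⟩ := exists_basis_toMatrix_eq_conj b hg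
  refine ⟨_, inferInstance, inferInstance, b', ?_⟩
  have hmap := map_sum_ofReal_smul (ι := ι) (LinearMap.toMatrixAlgEquiv b').toAlgHom
  refine conjTranspose_eq_neg_of_moment_eq_zero c hanti hcyc _ (fun i j => ?_) ?_ fun x hx => ?_
  · rw [← map_mul, ← map_mul, ← map_sub, hbr]
    exact hmap _ _
  · simp only [hb']
    exact hmoment
  · have hB := (hmap x B).symm
    refine (congrArg _ hB).trans (Eq.trans ?_ (congrArg _ hB).symm)
    set A := ∑ k, (x k : ℂ) • B k with hA
    obtain ⟨z, hz⟩ := Module.End.exists_eigenvalue A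
    have htop := (hirr (Module.End.eigenspace A z) fun i v hv => by
      rw [Submodule.mem_comap, Module.End.mem_eigenspace_iff] at *
      rw [← Module.End.mul_apply, ← commute_sum_smul_of_central hcyc hbr hx i,
        Module.End.mul_apply, ← hA, hv, map_smul]).resolve_left hz
    have hAz : A = z • 1 := LinearMap.ext fun v =>
      Module.End.mem_eigenspace_iff.mp (htop ▸ Submodule.mem_top)
    obtain ⟨v, hv⟩ := hz.exists_hasEigenvector
    obtain ⟨p, -, hp, hroot⟩ := hcentral x hx
    have hpz : p.IsRoot z := by
      have := Module.End.aeval_apply_of_hasEigenvector hv (p := p)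
      rw [← hA] at hp
      rw [hp, LinearMap.zero_apply, eq_comm, smul_eq_zero] at this
      exact this.resolve_right hv.2
    change (LinearMap.toMatrixAlgEquiv b' A)ᴴ = -LinearMap.toMatrixAlgEquiv b' A
    rw [hAz, map_smul, map_one]
    exact conjTranspose_real_smul_eq_neg (hroot z hpz)

/-- A finite-dimensional representation of a compact Lie algebra whose centre acts semisimply with
imaginary eigenvalues is skew-Hermitian in a suitable basis. Here `c` are the structure constants
with respect to an orthonormal basis for an invariant inner product. -/
theorem exists_basis_conjTranspose_eq_neg (c : ι → ι → ι → ℝ)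
    (hanti : ∀ i j k, c j i k = -c i j k) (hcyc : ∀ i j k, c j k i = c i j k)
    (V : Type*) [AddCommGroup V] [Module ℂ V] [FiniteDimensional ℂ V] (B : ι → Module.End ℂ V)
    (hbr : ∀ i j, B i * B j - B j * B i = ∑ k, (c i j k : ℂ) • B k)
    (hcentral : ∀ x : ι → ℝ, (∀ i j, ∑ k, c i j k * x k = 0) →
      IsImaginarySemisimple (∑ k, (x k : ℂ) • B k)) :
    ∃ (κ : Type) (_ : Fintype κ) (_ : DecidableEq κ) (b : Module.Basis κ ℂ V),
      ∀ i, (LinearMap.toMatrixAlgEquiv b (B i))ᴴ = -LinearMap.toMatrixAlgEquiv b (B i) := by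
  induction hN : Module.finrank ℂ V using Nat.strong_induction_on generalizing V with
  | _ N ih =>
  subst hN
  rcases subsingleton_or_nontrivial V with hV | hV
  · exact ⟨Empty, inferInstance, inferInstance, Module.Basis.empty V, fun i =>
      Matrix.ext fun j => j.elim⟩
  by_cases hirr : ∀ W : Submodule ℂ V, (∀ i, W ≤ W.comap (B i)) → W = ⊥ ∨ W = ⊤
  · exact exists_basis_conjTranspose_eq_neg_of_irreducible c hanti hcyc B hbr hcentral hirr
  push Not at hirr
  obtain ⟨W, hW, hbot, htop⟩ := hirr
  have hsub : ∀ (x : ι → ℝ), W.subtype ∘ₗ (∑ k, (x k : ℂ) • (B k).restrict (hW k))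
      = (∑ k, (x k : ℂ) • B k) ∘ₗ W.subtype := fun x => by
    ext v
    simp
  have hquot : ∀ (x : ι → ℝ), W.mkQ ∘ₗ (∑ k, (x k : ℂ) • B k)
      = (∑ k, (x k : ℂ) • W.mapQ W (B k) (hW k)) ∘ₗ W.mkQ := fun x => by
    ext v
    simp
  obtain ⟨m, _, _, bW, hbW⟩ := ih _ (Submodule.finrank_lt htop) W
    (fun i => (B i).restrict (hW i))
    (fun i j => LinearMap.ext fun v => W.subtype_injective (by
      have h1 := LinearMap.congr_fun (hsub (c i j)) v
      rw [← hbr] at h1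
      rw [← LinearMap.comp_apply, ← LinearMap.comp_apply, h1]
      rfl))
    (fun x hx => (hcentral x hx).of_injective W.subtype_injective (hsub x)) rfl
  have hlt : Module.finrank ℂ (V ⧸ W) < Module.finrank ℂ V := by
    have h1 := W.finrank_quotient_add_finrank
    have h2 := Submodule.one_le_finrank_iff.mpr hbot
    omega
  obtain ⟨n, _, _, bQ, hbQ⟩ := ih _ hlt (V ⧸ W)
    (fun i => W.mapQ W (B i) (hW i))
    (fun i j => LinearMap.ext fun v => by
      obtain ⟨v, rfl⟩ := W.mkQ_surjective v
      have h1 := LinearMap.congr_fun (hquot (c i j)) v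
      rw [← hbr] at h1
      rw [← LinearMap.comp_apply (∑ k, _), ← h1]
      rfl)
    (fun x hx => (hcentral x hx).of_surjective W.mkQ_surjective (hquot x)) rfl
  choose f hf using fun i => toMatrixAlgEquiv_sumQuot bW bQ (B i) (hW i)
  let e := LinearMap.toMatrixAlgEquiv (bW.sumQuot bQ)
  set a := fun i => LinearMap.toMatrixAlgEquiv bW ((B i).restrict (hW i))
  set d := fun i => LinearMap.toMatrixAlgEquiv bQ (W.mapQ W (B i) (hW i))
  have hsum : ∀ x : ι → ℝ, e (∑ k, (x k : ℂ) • B k)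
      = fromBlocks (∑ k, x k • a k) (∑ k, x k • f k) 0 (∑ k, x k • d k) := fun x => by
    rw [← sum_smul_fromBlocks]
    refine (map_sum_ofReal_smul e.toAlgHom x B).trans (Finset.sum_congr rfl fun k _ => ?_)
    exact congrArg _ (hf k)
  have hbr' : ∀ i j, fromBlocks (a i * a j - a j * a i)
      (a i * f j + f i * d j - (a j * f i + f j * d i)) 0 (d i * d j - d j * d i)
      = fromBlocks (∑ k, c i j k • a k) (∑ k, c i j k • f k) 0 (∑ k, c i j k • d k) :=
    fun i j => by
      rw [← hsum, ← hbr, map_sub, map_mul, map_mul]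
      simp only [e, hf, fromBlocks_multiply, sub_eq_add_neg, fromBlocks_neg, fromBlocks_add]
      simp [a, d]
  simp only [fromBlocks_inj] at hbr'
  obtain ⟨T, hT⟩ := exists_splitting_of_conjTranspose_eq_neg c hanti hcyc a f d hbW hbQ
    (fun i j => (hbr' i j).1) (fun i j => (hbr' i j).2.2.2) (fun i j => (hbr' i j).2.1)
    fun x hx => by
      rw [← hsum]
      exact (hcentral x hx).map e.toAlgHom
  obtain ⟨b', hb'⟩ := exists_basis_toMatrix_eq_conj (bW.sumQuot bQ)
    (g := fromBlocks 1 T 0 1) (g' := fromBlocks 1 (-T) 0 1) (by simp [fromBlocks_multiply])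
  refine ⟨_, inferInstance, inferInstance, b', fun i => ?_⟩
  have hdiag : LinearMap.toMatrixAlgEquiv b' (B i) = fromBlocks (a i) 0 0 (d i) := by
    rw [hb', hf]
    simp only [fromBlocks_multiply, Matrix.mul_one, Matrix.one_mul, Matrix.mul_zero,
      Matrix.zero_mul, add_zero, zero_add, neg_zero, Matrix.mul_neg, hT i]
    congr 1
    simp only [a, d]
    abel
  rw [hdiag, fromBlocks_conjTranspose, fromBlocks_neg, hbW, hbQ, conjTranspose_zero,
    conjTranspose_zero, neg_zero, neg_zero]

end CompactLieAlgebra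

section CompactEmbedded

theorem exists_basis_orthonormal {M : Type*} [AddCommGroup M] [Module ℝ M] [FiniteDimensional ℝ M]
    (q : M →ₗ[ℝ] M →ₗ[ℝ] ℝ) (hsymm : ∀ x y, q x y = q y x) (hpos : ∀ x, x ≠ 0 → 0 < q x x) :
    ∃ e : Module.Basis (Fin (Module.finrank ℝ M)) ℝ M,
      ∀ i j, q (e i) (e j) = if i = j then 1 else 0 := by
  have hzero : ∀ x, q x x = 0 → x = 0 := fun x hx => by
    by_contra h
    exact (hpos x h).ne' hx
  let core : InnerProductSpace.Core ℝ M :=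
    { inner := fun x y => q x y
      conj_inner_symm := fun x y => hsymm y x
      re_inner_nonneg := fun x => by
        by_cases hx : x = 0
        · simp [hx]
        · exact (hpos x hx).le
      add_left := fun x y z => by simp
      smul_left := fun x y r => by simp
      definite := hzero }
  let _ : NormedAddCommGroup M := core.toNormedAddCommGroup
  let _ : InnerProductSpace ℝ M := InnerProductSpace.ofCore core.toCore
  refine ⟨(stdOrthonormalBasis ℝ M).toBasis, fun i j => ?_⟩
  rw [OrthonormalBasis.coe_toBasis]
  exact orthonormal_iff_ite.mp (stdOrthonormalBasis ℝ M).orthonormal i j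

theorem frobForm_commutator_of_skew {n : Type*} [Fintype n] {X Y Z : Matrix n n ℂ}
    (hX : Xᴴ = -X) :
    frobForm (X * Y - Y * X) Z = frobForm (Z * X - X * Z) Y := by
  rw [map_sub, LinearMap.sub_apply, frobForm_mul_left, frobForm_mul_right, hX,
    frobForm_symm _ Y, map_sub, Matrix.neg_mul, Matrix.mul_neg, map_neg, map_neg]
  ring

/-- Let `M` be a real Lie algebra faithfully represented by skew-Hermitian matrices through `ζ`.
Any complex representation `β` of `M` is skew-Hermitian in a suitable basis, provided that
the centre of `M` acts semisimply with imaginary eigenvalues. -/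
theorem exists_basis_conjTranspose_eq_neg_of_skew {M n V : Type*} [AddCommGroup M] [Module ℝ M]
    [FiniteDimensional ℝ M] [Fintype n] [AddCommGroup V] [Module ℂ V] [FiniteDimensional ℂ V]
    (ζ : M →ₗ[ℝ] Matrix n n ℂ) (β : M →+ Module.End ℂ V) (hinj : Function.Injective ζ)
    (hskew : ∀ x, (ζ x)ᴴ = -ζ x) (hβ : ∀ (r : ℝ) x, β (r • x) = (r : ℂ) • β x)
    (hbr : ∀ x y, ∃ z, ζ z = ζ x * ζ y - ζ y * ζ x ∧ β z = β x * β y - β y * β x)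
    (hcentral : ∀ x, (∀ y, ζ x * ζ y = ζ y * ζ x) → IsImaginarySemisimple (β x)) :
    ∃ (κ : Type) (_ : Fintype κ) (_ : DecidableEq κ) (b : Module.Basis κ ℂ V),
      ∀ x, (LinearMap.toMatrixAlgEquiv b (β x))ᴴ = -LinearMap.toMatrixAlgEquiv b (β x) := by
  choose z hzζ hzβ using hbr
  let q : M →ₗ[ℝ] M →ₗ[ℝ] ℝ := frobForm.compl₁₂ ζ ζ
  obtain ⟨e, he⟩ := exists_basis_orthonormal q (fun x y => frobForm_symm _ _)
    fun x hx => frobForm_pos _ fun h => hx (hinj (h.trans (map_zero ζ).symm))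
  have hexp : ∀ x, x = ∑ k, q x (e k) • e k := fun x => by
    have : ∀ k, q x (e k) = e.repr x k := fun k => by
      conv_lhs => rw [← e.sum_repr x]
      simp only [map_sum, map_smul, LinearMap.sum_apply, LinearMap.smul_apply, he, smul_eq_mul]
      simp
    simp only [this, e.sum_repr]
  have hβsum : ∀ x : Fin (Module.finrank ℝ M) → ℝ,
      β (∑ k, x k • e k) = ∑ k, (x k : ℂ) • β (e k) := fun x => by simp [map_sum, hβ]
  let c : Fin (Module.finrank ℝ M) → Fin (Module.finrank ℝ M) → Fin (Module.finrank ℝ M) → ℝ :=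
    fun i j k => q (z (e i) (e j)) (e k)
  have hc : ∀ i j k, c i j k
      = frobForm (ζ (e i) * ζ (e j) - ζ (e j) * ζ (e i)) (ζ (e k)) := fun i j k => by
    rw [← hzζ]
    rfl
  have hcyc : ∀ i j k, c j k i = c i j k := fun i j k => by
    rw [hc, hc, frobForm_commutator_of_skew (hskew _)]
  obtain ⟨κ, hκ, hκ', b, hb⟩ := exists_basis_conjTranspose_eq_neg c
    (fun i j k => by rw [hc, hc, ← neg_sub, map_neg, LinearMap.neg_apply]) hcyc V
    (fun i => β (e i)) (fun i j => by rw [← hzβ, ← hβsum, ← hexp]) (fun x hx => by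
      rw [← hβsum]
      refine hcentral _ fun y => ?_
      have hcomm : ∀ i, ζ (∑ k, x k • e k) * ζ (e i) = ζ (e i) * ζ (∑ k, x k • e k) :=
        fun i => by
          rw [eq_comm, ← sub_eq_zero, map_sum, Finset.mul_sum, Finset.sum_mul,
            ← Finset.sum_sub_distrib]
          have hterm : ∀ k, ζ (e i) * ζ (x k • e k) - ζ (x k • e k) * ζ (e i)
              = ∑ l, (c l i k * x k) • ζ (e l) := fun k => by
            rw [map_smul, mul_smul_comm, smul_mul_assoc, ← smul_sub, ← hzζ,
              hexp (z (e i) (e k)), map_sum, Finset.smul_sum]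
            refine Finset.sum_congr rfl fun l _ => ?_
            rw [map_smul, smul_smul, ← hcyc, mul_comm]
          simp only [hterm]
          rw [Finset.sum_comm]
          simp only [← Finset.sum_smul, hx, zero_smul, Finset.sum_const_zero]
      generalize ∑ k, x k • e k = w at hcomm ⊢
      rw [hexp y, map_sum]
      simp only [map_smul, Finset.mul_sum, Finset.sum_mul, mul_smul_comm, smul_mul_assoc, hcomm])
  refine ⟨κ, hκ, hκ', b, fun x => ?_⟩
  have hsum := map_sum_ofReal_smul (LinearMap.toMatrixAlgEquiv b).toAlgHom
    (fun k => q x (e k)) fun k => β (e k)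
  rw [← hβsum, ← hexp] at hsum
  change LinearMap.toMatrixAlgEquiv b (β x)
    = ∑ k, q x (e k) • LinearMap.toMatrixAlgEquiv b (β (e k)) at hsum
  rw [hsum, conjTranspose_sum_smul]
  simp only [hb, smul_neg, Finset.sum_neg_distrib]

end CompactEmbedded

section BoundedExponential

open NormedSpace Polynomial

section Real

variable {R : Type*} [NormedRing R] [NormedAlgebra ℝ R] [CompleteSpace R]

theorem exp_smul_mul_eq_add_of_mul_mul_eq_zero {M w : R} (h : M * (M * w) = 0) (t : ℝ) :
    exp (t • M) * w = w + t • (M * w) := by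
  have hconst : ∀ (v : R) (F : ℝ → R), (∀ s, HasDerivAt F 0 s) → F 0 = v → F t = v :=
    fun v F hF h0 => by
      rw [← h0]
      exact is_const_of_deriv_eq_zero (fun s => (hF s).differentiableAt) (fun s => (hF s).deriv) _ _
  have hfix : ∀ s : ℝ, exp (s • M) * (M * w) = M * w := fun s => by
    have hder : ∀ s, HasDerivAt (fun s : ℝ => exp (s • M) * (M * w)) 0 s := fun s => by
      simpa [mul_assoc, h] using (hasDerivAt_exp_smul_real M s).mul_const (M * w)
    have := is_const_of_deriv_eq_zero (fun s => (hder s).differentiableAt)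
      (fun s => (hder s).deriv) s 0
    simpa using this
  have := hconst w (fun s => exp (s • M) * w - s • (M * w)) (fun s => by
    have h1 := ((hasDerivAt_exp_smul_real M s).mul_const w).sub
      ((hasDerivAt_id s).smul_const (M * w))
    rw [mul_assoc, hfix, one_smul, sub_self] at h1
    exact h1) (by simp)
  exact sub_eq_iff_eq_add.mp this

theorem eq_zero_of_forall_exp_mul_le {r C : ℝ} (h : ∀ t : ℝ, Real.exp (t * r) ≤ C) : r = 0 := by
  by_contra hr
  have h1 := h (C / r)
  rw [div_mul_cancel₀ _ hr] at h1
  linarith [Real.add_one_le_exp C]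

theorem eq_zero_of_norm_exp_smul_le_of_mul_eq_smul {A w : R} {r C : ℝ}
    (hC : ∀ t : ℝ, ‖exp (t • A)‖ ≤ C) (hw : w ≠ 0) (h : A * w = r • w) : r = 0 := by
  have hM : (A - algebraMap ℝ R r) * w = 0 := by
    rw [sub_mul, h, Algebra.algebraMap_eq_smul_one, smul_one_mul, sub_self]
  refine eq_zero_of_forall_exp_mul_le (C := C) fun t => ?_
  have hexp : exp (t • A) * w = Real.exp (t * r) • w := by
    have hsplit : t • A = algebraMap ℝ R (t * r) + t • (A - algebraMap ℝ R r) := by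
      rw [map_mul, ← Algebra.smul_def, smul_sub]
      abel
    rw [hsplit, exp_add_of_commute_real (Algebra.commutes _ _), mul_assoc,
      exp_smul_mul_eq_add_of_mul_mul_eq_zero (by rw [hM, mul_zero]), hM, smul_zero, add_zero,
      ← algebraMap_exp_comm, ← Real.exp_eq_exp_ℝ, ← Algebra.smul_def]
  have h1 := (norm_mul_le (exp (t • A)) w).trans
    (mul_le_mul_of_nonneg_right (hC t) (norm_nonneg w))
  rw [hexp, norm_smul, Real.norm_eq_abs, Real.abs_exp] at h1
  exact le_of_mul_le_mul_right h1 (norm_pos_iff.mpr hw)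

end Real

open scoped Matrix.Norms.Operator in
theorem eq_zero_of_transpose_eq_of_norm_exp_smul_le {n : Type*} [Fintype n] [DecidableEq n]
    {Y : Matrix n n ℝ} (hY : Yᵀ = Y) {C : ℝ} (hC : ∀ t : ℝ, ‖exp (t • Y)‖ ≤ C) : Y = 0 := by
  have hH : Y.IsHermitian := by
    rw [Matrix.IsHermitian, conjTranspose_eq_transpose_of_trivial, hY]
  rw [← hH.eigenvalues_eq_zero_iff]
  funext j
  set v := (hH.eigenvectorBasis j).ofLp with hv
  have hv0 : v ≠ 0 := fun h => hH.eigenvectorBasis.orthonormal.ne_zero j (WithLp.ofLp_injective 2 h)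
  refine eq_zero_of_norm_exp_smul_le_of_mul_eq_smul (w := vecMulVec v v) hC (fun h => hv0 ?_) ?_
  · funext i
    have := congrFun (congrFun h i) i
    simpa [vecMulVec_apply] using this
  · rw [mul_vecMulVec, hv, hH.mulVec_eigenvectorBasis, smul_vecMulVec]

variable {R : Type*} [NormedRing R] [NormedAlgebra ℂ R] [CompleteSpace R]

theorem norm_exp_smul_mul_of_mul_mul_eq_zero {A w : R} {z : ℂ}
    (h : (A - algebraMap ℂ R z) * ((A - algebraMap ℂ R z) * w) = 0) (t : ℝ) :
    ‖exp (t • A) * w‖ = Real.exp (t * z.re) * ‖w + t • ((A - algebraMap ℂ R z) * w)‖ := by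
  have hsplit : t • A = algebraMap ℂ R (t * z) + t • (A - algebraMap ℂ R z) := by
    rw [map_mul, ← Algebra.smul_def, Complex.coe_smul, smul_sub]
    abel
  rw [hsplit, exp_add_of_commute_real (Algebra.commutes _ _), mul_assoc,
    exp_smul_mul_eq_add_of_mul_mul_eq_zero h, ← algebraMap_exp_comm, ← Complex.exp_eq_exp_ℂ,
    ← Algebra.smul_def, norm_smul, Complex.norm_exp]
  simp

theorem re_eq_zero_of_norm_exp_smul_le {A w : R} {z : ℂ} {C : ℝ}
    (hC : ∀ t : ℝ, ‖exp (t • A)‖ ≤ C) (hw : w ≠ 0) (h : (A - algebraMap ℂ R z) * w = 0) :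
    z.re = 0 := by
  refine eq_zero_of_forall_exp_mul_le (C := C) fun t => ?_
  have h1 := (norm_mul_le (exp (t • A)) w).trans
    (mul_le_mul_of_nonneg_right (hC t) (norm_nonneg w))
  rw [norm_exp_smul_mul_of_mul_mul_eq_zero (by rw [h, mul_zero]), h, smul_zero, add_zero] at h1
  exact le_of_mul_le_mul_right h1 (norm_pos_iff.mpr hw)

theorem mul_eq_zero_of_norm_exp_smul_le {A w : R} {z : ℂ} {C : ℝ}
    (hC : ∀ t : ℝ, ‖exp (t • A)‖ ≤ C)
    (h : (A - algebraMap ℂ R z) * ((A - algebraMap ℂ R z) * w) = 0) :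
    (A - algebraMap ℂ R z) * w = 0 := by
  by_contra hne
  have hz := re_eq_zero_of_norm_exp_smul_le hC hne h
  set v := (A - algebraMap ℂ R z) * w
  have hbound : ∀ t : ℝ, ‖w + t • v‖ ≤ C * ‖w‖ := fun t => by
    have h1 := norm_exp_smul_mul_of_mul_mul_eq_zero h t
    rw [hz, mul_zero, Real.exp_zero, one_mul] at h1
    rw [← h1]
    exact (norm_mul_le _ w).trans (mul_le_mul_of_nonneg_right (hC t) (norm_nonneg w))
  have hv : 0 < ‖v‖ := norm_pos_iff.mpr hne
  set t : ℝ := (C * ‖w‖ + ‖w‖ + 1) / ‖v‖ with ht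
  have h2 : ‖t • v‖ ≤ ‖w + t • v‖ + ‖w‖ := by
    simpa using norm_sub_le (w + t • v) w
  have h3 : t * ‖v‖ = C * ‖w‖ + ‖w‖ + 1 := div_mul_cancel₀ _ hv.ne'
  have h4 : t * ‖v‖ ≤ ‖t • v‖ := by
    rw [norm_smul]
    exact mul_le_mul_of_nonneg_right (le_abs_self t) hv.le
  linarith [hbound t]

/-- A generator of a bounded one-parameter group is semisimple with imaginary spectrum. -/
theorem isImaginarySemisimple_of_norm_exp_smul_le [FiniteDimensional ℂ R] {A : R} {C : ℝ}
    (hC : ∀ t : ℝ, ‖exp (t • A)‖ ≤ C) : IsImaginarySemisimple A := by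
  have hp0 : minpoly ℂ A ≠ 0 := minpoly.ne_zero (Algebra.IsIntegral.isIntegral A)
  have hfactor : ∀ z r, minpoly ℂ A = (X - Polynomial.C z) * r → aeval A r ≠ 0 :=
    fun z r hr h0 => by
      have hr0 : r ≠ 0 := fun h => hp0 (by rw [hr, h, mul_zero])
      have hdeg := natDegree_le_natDegree (minpoly.degree_le_of_ne_zero ℂ A hr0 h0)
      rw [hr, natDegree_mul (X_sub_C_ne_zero z) hr0, natDegree_X_sub_C] at hdeg
      omega
  have heval : ∀ z r, aeval A ((X - Polynomial.C z) * r)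
      = (A - algebraMap ℂ R z) * aeval A r := fun z r => by simp
  refine ⟨minpoly ℂ A, ?_, minpoly.aeval ℂ A, fun z hz => ?_⟩
  · rw [isCoprime_iff_aeval_ne_zero_of_isAlgClosed ℂ ℂ]
    by_contra! hcon
    obtain ⟨z, hz, hz'⟩ := hcon
    rw [coe_aeval_eq_eval] at hz hz'
    obtain ⟨r, hr⟩ := dvd_iff_isRoot.mpr hz
    have hrz : r.IsRoot z := by
      rw [hr, derivative_mul] at hz'
      simpa using hz'
    obtain ⟨s, hs⟩ := dvd_iff_isRoot.mpr hrz
    refine hfactor z r hr ?_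
    rw [hs, heval]
    refine mul_eq_zero_of_norm_exp_smul_le hC ?_
    rw [← heval, ← heval, ← hs, ← hr, minpoly.aeval]
  · obtain ⟨r, hr⟩ := dvd_iff_isRoot.mpr hz
    exact re_eq_zero_of_norm_exp_smul_le hC (hfactor z r hr) (by
      rw [← heval, ← hr, minpoly.aeval])

end BoundedExponential

section LieAlgebra

open LinearMap

variable {n : Type*} {E : Type*} [Ring E] [Algebra ℂ E]

/-- Pairs consisting of a fixed vector and an anti-fixed vector of the involution
`(X, A, A') ↦ (-Xᵀ, A', A)`. -/
def cartanPairs (𝔤 : Submodule ℝ (Matrix n n ℝ × E × E)) :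
    Submodule ℝ ((Matrix n n ℝ × E × E) × (Matrix n n ℝ × E × E)) where
  carrier := {p | p.1 ∈ 𝔤 ∧ p.2 ∈ 𝔤 ∧ p.1.1ᵀ = -p.1.1 ∧ p.1.2.2 = p.1.2.1 ∧
    p.2.1ᵀ = p.2.1 ∧ p.2.2.2 = -p.2.2.1}
  zero_mem' := by simp
  add_mem' := by
    rintro p q ⟨h1, h2, h3, h4, h5, h6⟩ ⟨k1, k2, k3, k4, k5, k6⟩
    refine ⟨𝔤.add_mem h1 k1, 𝔤.add_mem h2 k2, ?_, ?_, ?_, ?_⟩ <;>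
      simp [*, Matrix.transpose_add, add_comm]
  smul_mem' := by
    rintro c p ⟨h1, h2, h3, h4, h5, h6⟩
    refine ⟨𝔤.smul_mem c h1, 𝔤.smul_mem c h2, ?_, ?_, ?_, ?_⟩ <;>
      simp [*, Matrix.transpose_smul]

/-- The matrix `X + iY` attached to a pair with matrix components `X` and `Y`. -/
noncomputable def complexMatrix (𝔤 : Submodule ℝ (Matrix n n ℝ × E × E)) :
    cartanPairs 𝔤 →ₗ[ℝ] Matrix n n ℂ where
  toFun p := p.1.1.1.map (algebraMap ℝ ℂ) + Complex.I • p.1.2.1.map (algebraMap ℝ ℂ)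
  map_add' p q := by
    ext i j
    simp
    ring
  map_smul' c p := by
    ext i j
    simp
    ring

/-- The element `A + iC` attached to a pair with second components `A` and `C`. -/
noncomputable def complexElement (𝔤 : Submodule ℝ (Matrix n n ℝ × E × E)) :
    cartanPairs 𝔤 →+ E where
  toFun p := p.1.1.2.1 + Complex.I • p.1.2.2.1
  map_zero' := by simp
  map_add' p q := by
    simp only [Submodule.coe_add, Prod.fst_add, Prod.snd_add, smul_add]
    abel

theorem complexElement_real_smul (𝔤 : Submodule ℝ (Matrix n n ℝ × E × E)) (r : ℝ)
    (p : cartanPairs 𝔤) : complexElement 𝔤 (r • p) = (r : ℂ) • complexElement 𝔤 p := by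
  change (r • p.1.1.2.1 + Complex.I • (r • p.1.2.2.1) : E) = (r : ℂ) • (p.1.1.2.1 + _)
  rw [← Complex.coe_smul, ← Complex.coe_smul, smul_add, smul_comm]

theorem complexMatrix_conjTranspose (𝔤 : Submodule ℝ (Matrix n n ℝ × E × E))
    (p : cartanPairs 𝔤) : (complexMatrix 𝔤 p)ᴴ = -complexMatrix 𝔤 p := by
  obtain ⟨p, h1, h2, h3, h4, h5, h6⟩ := p
  ext i j
  have hX := congrFun (congrFun h3 i) j
  have hY := congrFun (congrFun h5 i) j
  simp only [Matrix.transpose_apply, Matrix.neg_apply] at hX hY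
  simp [complexMatrix, hX, hY, add_comm]

theorem map_add_I_smul_map_injective {m : Type*} {X Y X' Y' : Matrix m m ℝ}
    (h : X.map (algebraMap ℝ ℂ) + Complex.I • Y.map (algebraMap ℝ ℂ)
      = X'.map (algebraMap ℝ ℂ) + Complex.I • Y'.map (algebraMap ℝ ℂ)) : X = X' ∧ Y = Y' := by
  constructor <;> ext i j
  · simpa using congrArg Complex.re (congrFun (congrFun h i) j)
  · simpa using congrArg Complex.im (congrFun (congrFun h i) j)

theorem exists_complex_commutator [Fintype n] {𝔤 : Submodule ℝ (Matrix n n ℝ × E × E)}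
    (hbr : ∀ x ∈ 𝔤, ∀ y ∈ 𝔤, x * y - y * x ∈ 𝔤) (p q : cartanPairs 𝔤) :
    ∃ r : cartanPairs 𝔤,
      complexMatrix 𝔤 r = complexMatrix 𝔤 p * complexMatrix 𝔤 q
        - complexMatrix 𝔤 q * complexMatrix 𝔤 p ∧
      complexElement 𝔤 r = complexElement 𝔤 p * complexElement 𝔤 q
        - complexElement 𝔤 q * complexElement 𝔤 p := by
  obtain ⟨⟨x, y⟩, h1, h2, h3, h4, h5, h6⟩ := p
  obtain ⟨⟨z, w⟩, k1, k2, k3, k4, k5, k6⟩ := q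
  dsimp only at h1 h2 h3 h4 h5 h6 k1 k2 k3 k4 k5 k6
  refine ⟨⟨((x * z - z * x) - (y * w - w * y), (x * w - w * x) + (y * z - z * y)),
    𝔤.sub_mem (hbr _ h1 _ k1) (hbr _ h2 _ k2), 𝔤.add_mem (hbr _ h1 _ k2) (hbr _ h2 _ k1),
    ?_, ?_, ?_, ?_⟩, ?_, ?_⟩
  · simp [Matrix.transpose_mul, *]
    abel
  · simp [*]
  · simp [Matrix.transpose_mul, *]
    abel
  · simp [*]
    abel
  · simp only [complexMatrix, LinearMap.coe_mk, AddHom.coe_mk, Prod.fst_sub, Prod.fst_add,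
      Prod.fst_mul]
    rw [← sub_eq_zero]
    simp only [add_mul, mul_add, smul_mul_assoc, mul_smul_comm, smul_smul, Complex.I_mul_I,
      smul_add, smul_sub, neg_smul, one_smul, Matrix.map_mul,
      Matrix.map_add _ (map_add (algebraMap ℝ ℂ)), Matrix.map_sub _ (map_sub (algebraMap ℝ ℂ))]
    abel
  · simp only [complexElement, AddMonoidHom.coe_mk, ZeroHom.coe_mk, Prod.fst_sub, Prod.fst_add,
      Prod.fst_mul, Prod.snd_sub, Prod.snd_add, Prod.snd_mul]
    simp only [add_mul, mul_add, smul_mul_assoc, mul_smul_comm, smul_smul, Complex.I_mul_I,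
      smul_add, smul_sub, neg_smul, one_smul]
    abel

theorem exists_basis_conjTranspose_eq_neg_swap [Fintype n] [DecidableEq n]
    {V : Type*} [AddCommGroup V] [Module ℂ V] [FiniteDimensional ℂ V] [FiniteDimensional ℝ E]
    {𝔤 : Submodule ℝ (Matrix n n ℝ × E × E)} (π : E →ₐ[ℂ] Module.End ℂ V)
    (hbr : ∀ x ∈ 𝔤, ∀ y ∈ 𝔤, x * y - y * x ∈ 𝔤)
    (hswap : ∀ X A A', (X, A, A') ∈ 𝔤 → (-Xᵀ, A', A) ∈ 𝔤)
    (hzero : ∀ A A', ((0 : Matrix n n ℝ), A, A') ∈ 𝔤 → A = 0)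
    (hsymm : ∀ x ∈ 𝔤, (∀ y ∈ 𝔤, x.1 * y.1 = y.1 * x.1) → x.1ᵀ = x.1 → x.1 = 0)
    (hcentral : ∀ x ∈ 𝔤, (∀ y ∈ 𝔤, x.1 * y.1 = y.1 * x.1) → IsImaginarySemisimple x.2.1) :
    ∃ (κ : Type) (_ : Fintype κ) (_ : DecidableEq κ) (b : Module.Basis κ ℂ V), ∀ x ∈ 𝔤,
      (toMatrixAlgEquiv b (π x.2.2))ᴴ = -toMatrixAlgEquiv b (π x.2.1) := by
  have hfix : ∀ x ∈ 𝔤, ((x.1 - x.1ᵀ, x.2.1 + x.2.2, x.2.1 + x.2.2),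
      (0 : Matrix n n ℝ × E × E)) ∈ cartanPairs 𝔤 := by
    rintro ⟨X, A, A'⟩ hx
    refine ⟨?_, 𝔤.zero_mem, ?_, ?_, ?_, ?_⟩
    · have h := 𝔤.add_mem hx (hswap _ _ _ hx)
      rw [Prod.mk_add_mk, Prod.mk_add_mk, add_comm A' A, ← sub_eq_add_neg] at h
      exact h
    all_goals simp
  have hanti : ∀ x ∈ 𝔤, ((0 : Matrix n n ℝ × E × E),
      (x.1 + x.1ᵀ, x.2.1 - x.2.2, x.2.2 - x.2.1)) ∈ cartanPairs 𝔤 := by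
    rintro ⟨X, A, A'⟩ hx
    refine ⟨𝔤.zero_mem, ?_, ?_, ?_, ?_, ?_⟩
    · have h := 𝔤.sub_mem hx (hswap _ _ _ hx)
      rw [Prod.mk_sub_mk, Prod.mk_sub_mk, sub_neg_eq_add] at h
      exact h
    all_goals simp [add_comm]
  have hinj : Function.Injective (complexMatrix 𝔤) := by
    refine (injective_iff_map_eq_zero _).mpr fun p hp => ?_
    obtain ⟨hX, hY⟩ := map_add_I_smul_map_injective (X' := 0) (Y' := 0) (hp.trans (by simp))
    obtain ⟨⟨⟨X, A, A'⟩, Y, C, C'⟩, h1, h2, h3, h4, h5, h6⟩ := p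
    dsimp only at h1 h2 h3 h4 h5 h6 hX hY
    subst hX hY h4 h6
    obtain rfl := hzero _ _ h1
    obtain rfl := hzero _ _ h2
    simp
  have hsemisimple : ∀ p : cartanPairs 𝔤,
      (∀ q, complexMatrix 𝔤 p * complexMatrix 𝔤 q = complexMatrix 𝔤 q * complexMatrix 𝔤 p) →
      IsImaginarySemisimple (π (complexElement 𝔤 p)) := by
    intro p hp
    have hcomm : ∀ x ∈ 𝔤, p.1.1.1 * x.1 = x.1 * p.1.1.1 ∧ p.1.2.1 * x.1 = x.1 * p.1.2.1 := by
      intro x hx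
      have h1 := hp ⟨_, hfix x hx⟩
      have h2 := hp ⟨_, hanti x hx⟩
      simp only [complexMatrix, LinearMap.coe_mk, AddHom.coe_mk, Prod.fst_zero,
        Matrix.map_zero _ (map_zero (algebraMap ℝ ℂ)), smul_zero, add_zero, zero_add, add_mul,
        mul_add, mul_smul_comm, smul_mul_assoc, ← Matrix.map_mul] at h1 h2
      rw [← smul_add] at h2
      replace h2 := smul_right_injective _ Complex.I_ne_zero h2
      obtain ⟨h3, h4⟩ := map_add_I_smul_map_injective h1
      obtain ⟨h5, h6⟩ := map_add_I_smul_map_injective h2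
      rw [mul_sub, sub_mul] at h3 h4
      exact ⟨by linear_combination (norm := module) (1 / 2 : ℝ) • h3 + (1 / 2 : ℝ) • h5,
        by linear_combination (norm := module) (1 / 2 : ℝ) • h4 + (1 / 2 : ℝ) • h6⟩
    obtain ⟨⟨⟨X, A, A'⟩, Y, C, C'⟩, k1, k2, k3, k4, k5, k6⟩ := p
    dsimp only at k1 k2 k5 hcomm
    obtain rfl : Y = 0 := hsymm _ k2 (fun x hx => (hcomm x hx).2) k5
    obtain rfl := hzero _ _ k2
    change IsImaginarySemisimple (π (A + Complex.I • 0))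
    rw [smul_zero, add_zero]
    exact (hcentral _ k1 fun x hx => (hcomm x hx).1).map π
  obtain ⟨κ, hκ, hκ', b, hb⟩ := exists_basis_conjTranspose_eq_neg_of_skew (complexMatrix 𝔤)
    ((π : E →+ Module.End ℂ V).comp (complexElement 𝔤)) hinj (complexMatrix_conjTranspose 𝔤)
    (fun r p => by
      change π _ = (r : ℂ) • π _
      rw [complexElement_real_smul, map_smul])
    (fun p q => by
      obtain ⟨r, hr, hr'⟩ := exists_complex_commutator hbr p q
      exact ⟨r, hr, by simp [hr']⟩) hsemisimple
  refine ⟨κ, hκ, hκ', b, fun x hx => ?_⟩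
  have h1 := hb ⟨_, hfix x hx⟩
  have h2 := hb ⟨_, hanti x hx⟩
  change (toMatrixAlgEquiv b (π ((x.2.1 + x.2.2) + Complex.I • 0)))ᴴ
    = -toMatrixAlgEquiv b (π ((x.2.1 + x.2.2) + Complex.I • 0)) at h1
  change (toMatrixAlgEquiv b (π (0 + Complex.I • (x.2.1 - x.2.2))))ᴴ
    = -toMatrixAlgEquiv b (π (0 + Complex.I • (x.2.1 - x.2.2))) at h2
  simp only [smul_zero, add_zero, zero_add, map_add, map_sub, map_smul,
    Matrix.conjTranspose_add, Matrix.conjTranspose_sub, Matrix.conjTranspose_smul,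
    Complex.star_def, Complex.conj_I, neg_smul, neg_inj] at h1 h2
  replace h2 := smul_right_injective _ Complex.I_ne_zero h2
  linear_combination (norm := module) (1 / 2 : ℂ) • h1 - (1 / 2 : ℂ) • h2

end LieAlgebra

section Representation

open Filter Topology NormedSpace
open scoped Matrix.Norms.Operator

/-- In a connected group mapping onto a closed subgroup of the unit group of a Banach algebra,
a subgroup containing all exponentials is everything. -/
theorem eq_top_of_forall_eq_expUnit {G 𝔸 : Type*} [Group G] [TopologicalSpace G]
    [IsTopologicalGroup G] [ConnectedSpace G] [NormedRing 𝔸] [NormedAlgebra ℝ 𝔸] [CompleteSpace 𝔸]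
    [FiniteDimensional ℝ 𝔸] {φ : G →* 𝔸ˣ} (hφ : Continuous φ)
    (hΓ : IsClosed (φ.range : Set 𝔸ˣ)) {H : Subgroup G}
    (hH : ∀ g, ∀ x ∈ lieSubmodule φ.range hΓ, φ g = expUnit x → g ∈ H) : H = ⊤ := by
  have h1 : (H : Set G) ∈ 𝓝 1 := by
    have h := (map_one φ ▸ hφ.tendsto 1).eventually (eventually_mem_exists_expUnit hΓ)
    filter_upwards [h] with g hg
    obtain ⟨x, hx, hgx⟩ := hg ⟨g, rfl⟩
    exact hH g x hx hgx
  have hopen := H.isOpen_of_mem_nhds h1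
  have hclopen : IsClopen (H : Set G) := ⟨H.isClosed_of_isOpen hopen, hopen⟩
  exact SetLike.coe_injective (hclopen.eq_univ ⟨1, H.one_mem⟩)

theorem eq_zero_of_forall_exp_smul_eq_one {𝔸 : Type*} [NormedRing 𝔸] [NormedAlgebra ℝ 𝔸]
    [CompleteSpace 𝔸] {x : 𝔸} (h : ∀ t : ℝ, exp (t • x) = 1) : x = 0 := by
  have hd := hasDerivAt_exp_smul_real x 0
  simp only [h, one_mul] at hd
  exact hd.unique (hasDerivAt_const 0 1)

variable {G : Type*} [Group G] {n : Type*} [Fintype n] [DecidableEq n]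
  {E : Type*} [NormedRing E]

/-- The homomorphism `g ↦ (g, ρ g, ρ (θ g))`. -/
def graphHom (ι : G →* Matrix n n ℝ) (ρ : G →* E) (θ : G →* G) :
    G →* (Matrix n n ℝ × E × E)ˣ :=
  (ι.prod (ρ.prod (ρ.comp θ))).toHomUnits

theorem coe_graphHom (ι : G →* Matrix n n ℝ) (ρ : G →* E) (θ : G →* G) (g : G) :
    (graphHom ι ρ θ g : Matrix n n ℝ × E × E) = (ι g, ρ g, ρ (θ g)) := rfl

variable [CompleteSpace E]

theorem continuous_graphHom [TopologicalSpace G] {ι : G →* Matrix n n ℝ} (hι : Continuous ι)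
    {ρ : G →* E} (hρ : Continuous ρ) {θ : G →* G} (hθ : Continuous θ) :
    Continuous (graphHom ι ρ θ) :=
  Units.isOpenEmbedding_val.isEmbedding.continuous_iff.mpr (hι.prodMk (hρ.prodMk (hρ.comp hθ)))

variable [NormedAlgebra ℂ E]

theorem graphHom_eq_expUnit_iff {ι : G →* Matrix n n ℝ} {ρ : G →* E} {θ : G →* G} {g : G}
    {x : Matrix n n ℝ × E × E} : graphHom ι ρ θ g = expUnit x ↔
      ι g = exp x.1 ∧ ρ g = exp x.2.1 ∧ ρ (θ g) = exp x.2.2 := by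
  let _ : NormedAlgebra ℚ (Matrix n n ℝ × E × E) := .restrictScalars ℚ ℝ _
  let _ : NormedAlgebra ℚ (E × E) := .restrictScalars ℚ ℝ _
  let _ : NormedAlgebra ℚ E := .restrictScalars ℚ ℝ _
  let _ : NormedAlgebra ℚ (Matrix n n ℝ) := .restrictScalars ℚ ℝ _
  rw [Units.ext_iff, coe_graphHom, coe_expUnit, Prod.ext_iff, Prod.ext_iff, Prod.fst_exp,
    Prod.snd_exp, Prod.fst_exp, Prod.snd_exp]
  rfl

theorem mem_lieSubmodule_graphHom {ι : G →* Matrix n n ℝ} {ρ : G →* E} {θ : G →* G}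
    {hΓ : IsClosed ((graphHom ι ρ θ).range : Set (Matrix n n ℝ × E × E)ˣ)}
    {x : Matrix n n ℝ × E × E} : x ∈ lieSubmodule (graphHom ι ρ θ).range hΓ ↔
      ∀ t : ℝ, ∃ g, ι g = exp (t • x.1) ∧ ρ g = exp (t • x.2.1) ∧ ρ (θ g) = exp (t • x.2.2) :=
  mem_lieSubmodule.trans
    (forall_congr' fun _ => exists_congr fun _ => graphHom_eq_expUnit_iff)

theorem exists_basis_conjTranspose_mul_eq_one {V : Type*} [AddCommGroup V] [Module ℂ V]
    [FiniteDimensional ℂ V] [FiniteDimensional ℂ E] [TopologicalSpace G] [IsTopologicalGroup G]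
    [ConnectedSpace G]
    {ι : G →* Matrix n n ℝ} (hι : Continuous ι) (hinj : Function.Injective ι)
    {ρ : G →* E} (hρ : Continuous ρ) {θ : G →* G} (hθ : Continuous θ) (hθθ : ∀ g, θ (θ g) = g)
    (hιθ : ∀ g, ι (θ g) * (ι g)ᵀ = 1)
    (hΓ : IsClosed ((graphHom ι ρ θ).range : Set (Matrix n n ℝ × E × E)ˣ))
    (hcenter : IsCompact (Subgroup.center G : Set G)) (π : E →ₐ[ℂ] Module.End ℂ V) :
    ∃ (κ : Type) (_ : Fintype κ) (_ : DecidableEq κ) (b : Module.Basis κ ℂ V), ∀ g,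
      (LinearMap.toMatrixAlgEquiv b (π (ρ (θ g))))ᴴ
        * LinearMap.toMatrixAlgEquiv b (π (ρ g)) = 1 := by
  have hφ := continuous_graphHom hι hρ hθ
  have hboundι : ∃ C, ∀ z ∈ Subgroup.center G, ‖ι z‖ ≤ C := by
    obtain ⟨C, hC⟩ := (hcenter.image hι).isBounded.exists_norm_le
    exact ⟨C, fun z hz => hC _ ⟨z, hz, rfl⟩⟩
  have hboundρ : ∃ C, ∀ z ∈ Subgroup.center G, ‖ρ z‖ ≤ C := by
    obtain ⟨C, hC⟩ := (hcenter.image hρ).isBounded.exists_norm_le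
    exact ⟨C, fun z hz => hC _ ⟨z, hz, rfl⟩⟩
  set 𝔤 := lieSubmodule (graphHom ι ρ θ).range hΓ with h𝔤
  have hcent : ∀ x ∈ 𝔤, (∀ y ∈ 𝔤, x.1 * y.1 = y.1 * x.1) → ∀ t : ℝ, ∃ z ∈ Subgroup.center G,
      ι z = exp (t • x.1) ∧ ρ z = exp (t • x.2.1) := by
    intro x hx hcomm t
    obtain ⟨z, hz, hz', -⟩ := mem_lieSubmodule_graphHom.mp hx t
    refine ⟨z, ?_, hz, hz'⟩
    have htop : Subgroup.centralizer {z} = ⊤ := by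
      refine eq_top_of_forall_eq_expUnit hφ hΓ fun g y hy hgy => ?_
      rw [Subgroup.mem_centralizer_singleton_iff]
      refine hinj ?_
      rw [map_mul, map_mul, hz, (graphHom_eq_expUnit_iff.mp hgy).1]
      let _ : NormedAlgebra ℚ (Matrix n n ℝ) := .restrictScalars ℚ ℝ _
      exact (Commute.exp (Commute.smul_left (hcomm y hy) t)).eq.symm
    rw [Subgroup.mem_center_iff]
    intro g
    have hg : g ∈ Subgroup.centralizer {z} := htop ▸ Subgroup.mem_top g
    exact (Subgroup.mem_centralizer_singleton_iff.mp hg)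
  have : FiniteDimensional ℝ E := FiniteDimensional.complexToReal E
  obtain ⟨κ, hκ, hκ', b, hb⟩ := exists_basis_conjTranspose_eq_neg_swap (𝔤 := 𝔤) π
    (fun x hx y hy => commutator_mem_lieSubmodule hx hy)
    (fun X A A' hx => by
      refine mem_lieSubmodule_graphHom.mpr fun t => ?_
      obtain ⟨g, h1, h2, h3⟩ := mem_lieSubmodule_graphHom.mp hx t
      refine ⟨θ g, ?_, h3, by rw [hθθ, h2]⟩
      have hinv := hιθ g
      rw [h1, ← Matrix.exp_transpose, Matrix.transpose_smul] at hinv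
      rw [smul_neg]
      exact left_inv_eq_right_inv hinv (exp_mul_exp_neg_real _))
    (fun A A' hx => by
      refine eq_zero_of_forall_exp_smul_eq_one fun t => ?_
      obtain ⟨g, h1, h2, -⟩ := mem_lieSubmodule_graphHom.mp hx t
      obtain rfl : g = 1 := hinj (by rw [h1, map_one, smul_zero, exp_zero])
      rw [← h2, map_one])
    (fun x hx hcomm hsymm => by
      obtain ⟨C, hC⟩ := hboundι
      refine eq_zero_of_transpose_eq_of_norm_exp_smul_le (C := C) hsymm fun t => ?_
      obtain ⟨z, hz, h1, -⟩ := hcent x hx hcomm t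
      exact h1 ▸ hC z hz)
    (fun x hx hcomm => by
      obtain ⟨C, hC⟩ := hboundρ
      refine isImaginarySemisimple_of_norm_exp_smul_le (C := C) fun t => ?_
      obtain ⟨z, hz, -, h1⟩ := hcent x hx hcomm t
      exact h1 ▸ hC z hz)
  refine ⟨κ, hκ, hκ', b, ?_⟩
  let M : G →* Matrix κ κ ℂ :=
    ((LinearMap.toMatrixAlgEquiv b : Module.End ℂ V →* Matrix κ κ ℂ).comp
      (π : E →* Module.End ℂ V)).comp ρ
  let H : Subgroup G :=
    { carrier := {g | (M (θ g))ᴴ * M g = 1}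
      one_mem' := by simp
      mul_mem' := fun {g h} hg hh => by
        change (M (θ g))ᴴ * M g = 1 at hg
        change (M (θ h))ᴴ * M h = 1 at hh
        change (M (θ (g * h)))ᴴ * M (g * h) = 1
        rw [map_mul, map_mul, map_mul, Matrix.conjTranspose_mul, mul_assoc,
          ← mul_assoc _ (M g), hg, one_mul, hh]
      inv_mem' := fun {g} hg => by
        change (M (θ g))ᴴ * M g = 1 at hg
        change (M (θ g⁻¹))ᴴ * M g⁻¹ = 1
        have h1 : M g * M g⁻¹ = 1 := by rw [← map_mul, mul_inv_cancel, map_one]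
        have h2 : (M (θ g⁻¹))ᴴ * (M (θ g))ᴴ = 1 := by
          rw [← Matrix.conjTranspose_mul, ← map_mul, ← map_mul, mul_inv_cancel, map_one, map_one,
            Matrix.conjTranspose_one]
        rw [left_inv_eq_right_inv h2 hg, h1] }
  have hH : H = ⊤ := by
    refine eq_top_of_forall_eq_expUnit hφ hΓ fun g x hx hgx => ?_
    obtain ⟨-, h2, h3⟩ := graphHom_eq_expUnit_iff.mp hgx
    have hexp : ∀ a : E, LinearMap.toMatrixAlgEquiv b (π (exp a))
        = exp (LinearMap.toMatrixAlgEquiv b (π a)) := fun a => by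
      let f : E →ₐ[ℂ] Matrix κ κ ℂ := (LinearMap.toMatrixAlgEquiv b).toAlgHom.comp π
      have hf : Continuous f := f.toLinearMap.continuous_of_finiteDimensional
      let _ : NormedAlgebra ℚ E := .restrictScalars ℚ ℝ _
      let _ : NormedAlgebra ℚ (Matrix κ κ ℂ) := .restrictScalars ℚ ℝ _
      exact map_exp f hf a
    change (LinearMap.toMatrixAlgEquiv b (π (ρ (θ g))))ᴴ
        * LinearMap.toMatrixAlgEquiv b (π (ρ g)) = 1
    rw [h2, h3, hexp, hexp, ← Matrix.exp_conjTranspose, hb x hx]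
    have h := exp_mul_exp_neg_real (-LinearMap.toMatrixAlgEquiv b (π x.2.1))
    rwa [neg_neg] at h
  intro g
  exact (hH ▸ Subgroup.mem_top g : g ∈ H)

end Representation

section TransposeInverse

variable {n : Type*} [Fintype n] [DecidableEq n]

/-- The automorphism `g ↦ (gᵀ)⁻¹` of the general linear group. -/
def transposeInv : Matrix.GeneralLinearGroup n ℝ →* Matrix.GeneralLinearGroup n ℝ where
  toFun g := ⟨(g⁻¹ : Matrix.GeneralLinearGroup n ℝ).valᵀ, g.valᵀ,
    by rw [← Matrix.transpose_mul, g.mul_inv, Matrix.transpose_one],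
    by rw [← Matrix.transpose_mul, g.inv_mul, Matrix.transpose_one]⟩
  map_one' := Units.ext (by simp)
  map_mul' g h := Units.ext (by
    change ((g * h)⁻¹).valᵀ = g⁻¹.valᵀ * h⁻¹.valᵀ
    rw [_root_.mul_inv_rev, Units.val_mul, Matrix.transpose_mul])

theorem transposeInv_transposeInv (g : Matrix.GeneralLinearGroup n ℝ) :
    transposeInv (transposeInv g) = g :=
  Units.ext (Matrix.transpose_transpose _)

theorem transposeInv_mul_transpose (g : Matrix.GeneralLinearGroup n ℝ) :
    (transposeInv g).val * g.valᵀ = 1 := (transposeInv g).mul_inv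

theorem continuous_transposeInv :
    Continuous (transposeInv : Matrix.GeneralLinearGroup n ℝ →* _) :=
  Units.continuous_iff.mpr ⟨Units.continuous_coe_inv.matrix_transpose,
    Units.continuous_val.matrix_transpose⟩

theorem transposeInv_eq_inv_iff {g h : Matrix.GeneralLinearGroup n ℝ} :
    transposeInv g = h⁻¹ ↔ h.val = g.valᵀ := by
  rw [eq_inv_iff_mul_eq_one, mul_eq_one_iff_inv_eq, eq_comm, Units.ext_iff]
  rfl

end TransposeInverse

open scoped ComplexOrder in
theorem re_star_dotProduct_self_pos {κ : Type*} [Fintype κ] {v : κ → ℂ} (hv : v ≠ 0) :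
    0 < (star v ⬝ᵥ v).re :=
  (Complex.pos_iff.mp (Matrix.dotProduct_star_self_pos_iff.mpr hv)).1

/-- A closed connected transpose-stable subgroup of `GL(n, ℝ)` with compact centre:
every continuous finite-dimensional complex representation admits an admissible
Hermitian inner product, i.e. one for which `⟨ρ(g)u, v⟩ = ⟨u, ρ(gᵀ)v⟩`. -/
theorem exists_admissible_metric
    (n : ℕ) (G : Subgroup (Matrix.GeneralLinearGroup (Fin n) ℝ))
    (hclosed : IsClosed (G : Set (Matrix.GeneralLinearGroup (Fin n) ℝ)))
    (hconn : IsConnected (G : Set (Matrix.GeneralLinearGroup (Fin n) ℝ)))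
    (htrans : ∀ g ∈ G, ∃ h ∈ G,
      ((h : Matrix (Fin n) (Fin n) ℝ)) = ((g : Matrix (Fin n) (Fin n) ℝ))ᵀ)
    (hcenter : IsCompact {g : Matrix.GeneralLinearGroup (Fin n) ℝ |
      g ∈ G ∧ ∀ h ∈ G, g * h = h * g})
    (V : Type*) [NormedAddCommGroup V] [NormedSpace ℂ V] [FiniteDimensional ℂ V]
    (ρ : G →* (V →L[ℂ] V)ˣ)
    (hρ : Continuous fun g : G => ((ρ g : V →L[ℂ] V) : V →L[ℂ] V)) :
    ∃ B : V → V → ℂ,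
      (∀ u v w : V, B u (v + w) = B u v + B u w) ∧
      (∀ (c : ℂ) (u v : V), B u (c • v) = c * B u v) ∧
      (∀ u v : V, B u v = conj (B v u)) ∧
      (∀ v : V, v ≠ 0 → 0 < (B v v).re) ∧
      (∀ g h : G,
        ((h : Matrix.GeneralLinearGroup (Fin n) ℝ) : Matrix (Fin n) (Fin n) ℝ)
          = (((g : Matrix.GeneralLinearGroup (Fin n) ℝ) : Matrix (Fin n) (Fin n) ℝ))ᵀ →
        ∀ u v : V, B ((ρ g : V →L[ℂ] V) u) v = B u ((ρ h : V →L[ℂ] V) v)) := by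
  have : ConnectedSpace G := isConnected_iff_connectedSpace.mp hconn
  have hmem : ∀ g : G, transposeInv (g : Matrix.GeneralLinearGroup (Fin n) ℝ) ∈ G := fun g => by
    obtain ⟨h, hh, hg⟩ := htrans g g.2
    rw [transposeInv_eq_inv_iff.mpr hg]
    exact G.inv_mem hh
  let θ : G →* G := (transposeInv.comp G.subtype).codRestrict G hmem
  have hθ : Continuous θ :=
    (continuous_transposeInv.comp continuous_subtype_val).subtype_mk hmem
  let ι : G →* Matrix (Fin n) (Fin n) ℝ := (Units.coeHom _).comp G.subtype
  have hι : Continuous ι := Units.continuous_val.comp continuous_subtype_val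
  let σ : G →* (V →L[ℂ] V) := (Units.coeHom _).comp ρ
  have hσ : Continuous σ := hρ
  let π : (V →L[ℂ] V) →ₐ[ℂ] Module.End ℂ V :=
    { ContinuousLinearMap.toLinearMapRingHom with commutes' := fun _ => rfl }
  have hΓ : IsClosed ((graphHom ι σ θ).range :
      Set (Matrix (Fin n) (Fin n) ℝ × (V →L[ℂ] V) × (V →L[ℂ] V))ˣ) := by
    have hφ := continuous_graphHom hι hσ hθ
    let p : (Matrix (Fin n) (Fin n) ℝ × (V →L[ℂ] V) × (V →L[ℂ] V))ˣ →*
        Matrix.GeneralLinearGroup (Fin n) ℝ :=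
      Units.map (MonoidHom.fst _ _)
    have hp : Continuous p := Continuous.units_map _ continuous_fst
    have hproper : IsProperMap (p ∘ graphHom ι σ θ) := by
      have hcomp : p ∘ graphHom ι σ θ = ((↑) : G → Matrix.GeneralLinearGroup (Fin n) ℝ) :=
        funext fun g => Units.ext rfl
      rw [hcomp]
      exact hclosed.isClosedEmbedding_subtypeVal.isProperMap
    exact (isProperMap_of_comp_of_t2 hφ hp hproper).isClosedMap.isClosed_range
  have hcompact : IsCompact (Subgroup.center G : Set G) := by
    rw [Subtype.isCompact_iff]
    convert hcenter using 1
    ext g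
    constructor
    · rintro ⟨g, hg, rfl⟩
      exact ⟨g.2, fun h hh =>
        congrArg Subtype.val (Subgroup.mem_center_iff.mp hg ⟨h, hh⟩).symm⟩
    · rintro ⟨hg, hcomm⟩
      exact ⟨⟨g, hg⟩, Subgroup.mem_center_iff.mpr fun h => Subtype.ext (hcomm h h.2).symm, rfl⟩
  obtain ⟨κ, _, _, b, hb⟩ := exists_basis_conjTranspose_mul_eq_one hι
    (fun g h hgh => Subtype.ext (Units.ext hgh)) hσ hθ
    (fun g => Subtype.ext (transposeInv_transposeInv _))
    (fun g => transposeInv_mul_transpose _) hΓ hcompact π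
  refine ⟨fun u v => star (⇑(b.repr u)) ⬝ᵥ ⇑(b.repr v), fun u v w => by simp, fun c u v => by simp,
    fun u v => ?_, fun v hv => ?_, fun g h hgh u v => ?_⟩
  · simp only [dotProduct, Pi.star_apply, map_sum, map_mul, Complex.star_def, Complex.conj_conj]
    exact Finset.sum_congr rfl fun j _ => mul_comm _ _
  · exact re_star_dotProduct_self_pos fun h =>
      hv (b.repr.map_eq_zero_iff.mp (DFunLike.coe_injective h))
  · have hθh : θ h = g⁻¹ := Subtype.ext
      (transposeInv_eq_inv_iff.mpr
        ((congrArg Matrix.transpose hgh).trans (Matrix.transpose_transpose _)).symm)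
    let M : G →* Matrix κ κ ℂ := (LinearMap.toMatrixAlgEquiv b : Module.End ℂ V →* _).comp
      ((π : (V →L[ℂ] V) →* Module.End ℂ V).comp σ)
    have hM : ∀ (k : G) (w : V), ⇑(b.repr ((ρ k : V →L[ℂ] V) w)) = M k *ᵥ b.repr w :=
      fun k w => (LinearMap.toMatrix_mulVec_repr b b _ w).symm
    have hMg : (M g)ᴴ * (M g⁻¹)ᴴ = 1 := by
      rw [← Matrix.conjTranspose_mul, ← map_mul, inv_mul_cancel, map_one,
        Matrix.conjTranspose_one]
    have hMh : (M g)ᴴ = M h := left_inv_eq_right_inv hMg (hθh ▸ hb h)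
    beta_reduce
    rw [hM, hM, Matrix.star_mulVec, hMh, Matrix.dotProduct_mulVec]
end

section
/- Let V = V⁺ ⊕ V⁻ be a finite-dimensional ℤ₂-graded complex vector space, D an odd endomorphism of V and A an even endomorphism of V with AD = DA. Let K = ⋃_{n≥1} ker(Dⁿ) be the generalized kernel of D. Then K is a graded subspace (K = (K ∩ V⁺) ⊕ (K ∩ V⁻)), A maps K into K, and the supertrace of A restricted to K equals the supertrace of A on all of V: Tr(A|_{K∩V⁺}) − Tr(A|_{K∩V⁻}) = Tr(A|_{V⁺}) − Tr(A|_{V⁻}). -/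
namespace LinearMap

variable {k V : Type*} [Field k] [AddCommGroup V] [Module k V]

/-- The trace of `f` on an internal direct sum of two invariant subspaces is the sum of the
traces on the summands. -/
lemma trace_restrict_eq_add_of_disjoint_of_sup_eq [FiniteDimensional k V] {a b c : Submodule k V}
    (hdisj : Disjoint a b) (hsup : a ⊔ b = c) (f : V →ₗ[k] V)
    (ha : ∀ v ∈ a, f v ∈ a) (hb : ∀ v ∈ b, f v ∈ b) (hc : ∀ v ∈ c, f v ∈ c) :
    trace k c (f.restrict hc) = trace k a (f.restrict ha) + trace k b (f.restrict hb) := by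
  have hac : a ≤ c := hsup ▸ le_sup_left
  have hbc : b ≤ c := hsup ▸ le_sup_right
  let g : (a × b) →ₗ[k] c := (Submodule.inclusion hac).coprod (Submodule.inclusion hbc)
  have hg : Function.Bijective g := by
    constructor
    · rw [injective_iff_map_eq_zero]
      rintro ⟨x, y⟩ hxy
      have h : (x : V) + y = 0 := congrArg Subtype.val hxy
      have hx : (x : V) = 0 := Submodule.disjoint_def.1 hdisj _ x.2 <| by
        rw [eq_neg_of_add_eq_zero_left h]
        exact b.neg_mem y.2
      have hy : (y : V) = 0 := by simpa [hx] using h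
      exact Prod.ext (Subtype.ext hx) (Subtype.ext hy)
    · rintro ⟨z, hz⟩
      obtain ⟨x, hx, y, hy, rfl⟩ := Submodule.mem_sup.1 (hsup ▸ hz)
      exact ⟨(⟨x, hx⟩, ⟨y, hy⟩), rfl⟩
  let e := LinearEquiv.ofBijective g hg
  have hconj : e.conj ((f.restrict ha).prodMap (f.restrict hb)) = f.restrict hc := by
    ext z
    obtain ⟨⟨x, y⟩, rfl⟩ := e.surjective z
    rw [LinearEquiv.conj_apply_apply, e.symm_apply_apply]
    exact (map_add f (x : V) y).symm
  rw [← hconj, trace_conj', trace_prodMap']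

/-- If `g` commutes with `f` and maps each of two `f`-invariant subspaces injectively into the
other, then `f` has the same trace on both. -/
lemma trace_restrict_eq_of_commute_of_mapsTo [FiniteDimensional k V] {a b : Submodule k V}
    {f g : V →ₗ[k] V} (hfg : f ∘ₗ g = g ∘ₗ f)
    (hab : ∀ v ∈ a, g v ∈ b) (hba : ∀ v ∈ b, g v ∈ a)
    (ha₀ : Disjoint a (ker g)) (hb₀ : Disjoint b (ker g))
    (ha : ∀ v ∈ a, f v ∈ a) (hb : ∀ v ∈ b, f v ∈ b) :
    trace k a (f.restrict ha) = trace k b (f.restrict hb) := by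
  have hinj {s t : Submodule k V} (hst : ∀ v ∈ s, g v ∈ t) (hs : Disjoint s (ker g)) :
      Function.Injective (g.restrict hst) := by
    rw [injective_iff_map_eq_zero]
    intro x hx
    exact Subtype.ext (Submodule.disjoint_def.1 hs _ x.2 (congrArg Subtype.val hx))
  have hrank : Module.finrank k a = Module.finrank k b :=
    le_antisymm (finrank_le_finrank_of_injective (hinj hab ha₀))
      (finrank_le_finrank_of_injective (hinj hba hb₀))
  let e := linearEquivOfInjective (g.restrict hab) (hinj hab ha₀) hrank
  have hconj : e.conj (f.restrict ha) = f.restrict hb := by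
    ext z
    obtain ⟨x, rfl⟩ := e.surjective z
    rw [LinearEquiv.conj_apply_apply, e.symm_apply_apply]
    exact (LinearMap.congr_fun hfg (x : V)).symm
  rw [← hconj, trace_conj']

lemma ker_eq_inf_sup_inf_of_isCompl {p q : Submodule k V} (hpq : IsCompl p q) {f : V →ₗ[k] V}
    (hp : ∀ v ∈ p, f v ∈ p) (hq : ∀ v ∈ q, f v ∈ q) :
    ker f = (ker f ⊓ p) ⊔ (ker f ⊓ q) := by
  refine le_antisymm (fun v hv => ?_) (sup_le inf_le_left inf_le_left)
  obtain ⟨x, hx, y, hy, rfl⟩ := Submodule.mem_sup.1 (hpq.sup_eq_top ▸ Submodule.mem_top (x := v))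
  have h : f x + f y = 0 := by rw [← map_add]; exact hv
  have hfx : f x = 0 := Submodule.disjoint_def.1 hpq.disjoint _ (hp x hx) <| by
    rw [eq_neg_of_add_eq_zero_left h]
    exact q.neg_mem (hq y hy)
  have hfy : f y = 0 := by simpa [hfx] using h
  exact Submodule.add_mem_sup ⟨hfx, hx⟩ ⟨hfy, hy⟩

lemma range_eq_inf_sup_inf_of_isCompl {p q : Submodule k V} (hpq : IsCompl p q) {f : V →ₗ[k] V}
    (hp : ∀ v ∈ p, f v ∈ p) (hq : ∀ v ∈ q, f v ∈ q) :
    range f = (range f ⊓ p) ⊔ (range f ⊓ q) := by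
  refine le_antisymm ?_ (sup_le inf_le_left inf_le_left)
  rintro _ ⟨v, rfl⟩
  obtain ⟨x, hx, y, hy, rfl⟩ := Submodule.mem_sup.1 (hpq.sup_eq_top ▸ Submodule.mem_top (x := v))
  rw [map_add]
  exact Submodule.add_mem_sup ⟨mem_range_self f x, hp x hx⟩ ⟨mem_range_self f y, hq y hy⟩

/-- The generalized kernel is the kernel of some positive even power, which is moreover a
complement of the range of that power. -/
lemma exists_iSup_ker_pow_succ_eq_ker_sq_pow [FiniteDimensional k V] (f : V →ₗ[k] V) :
    ∃ m : ℕ, (⨆ n : ℕ, ker (f ^ (n + 1))) = ker ((f ^ 2) ^ (m + 1)) ∧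
      IsCompl (ker ((f ^ 2) ^ (m + 1))) (range ((f ^ 2) ^ (m + 1))) := by
  obtain ⟨m, hm⟩ := Filter.eventually_atTop.1
    ((eventually_isCompl_ker_pow_range_pow f).and (eventually_iSup_ker_pow_eq f))
  obtain ⟨hcompl, hsup⟩ := hm (2 * (m + 1)) (by lia)
  rw [pow_mul] at hcompl hsup
  refine ⟨m, le_antisymm (iSup_le fun n => ?_) ?_, hcompl⟩
  · rw [← hsup]
    exact le_iSup (fun n => ker (f ^ n)) (n + 1)
  · rw [← pow_mul, show 2 * (m + 1) = 2 * m + 1 + 1 by ring]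
    exact le_iSup (fun n => ker (f ^ (n + 1))) (2 * m + 1)

lemma sup_inf_eq_of_graded {p q K R : Submodule k V} (hpq : Disjoint p q) (hKR : K ⊔ R = ⊤)
    (hK : K = (K ⊓ p) ⊔ (K ⊓ q)) (hR : R = (R ⊓ p) ⊔ (R ⊓ q)) :
    (K ⊓ p) ⊔ (R ⊓ p) = p := by
  refine eq_of_le_of_inf_le_of_le_sup (z := q) (sup_le inf_le_right inf_le_right) ?_ ?_
  · rw [hpq.eq_bot]
    exact bot_le
  · refine le_top.trans (hKR ▸ sup_le ?_ ?_)
    · rw [hK]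
      exact sup_le_sup (hK ▸ le_sup_left) inf_le_right
    · rw [hR]
      exact sup_le_sup (hR ▸ le_sup_right) inf_le_right

end LinearMap

/-- McKean–Singer type identity: if `V = p ⊕ q` is a finite-dimensional ℤ₂-graded complex
vector space, `D` is an odd endomorphism and `A` an even endomorphism commuting with `D`,
and `K = ⋃_{n ≥ 1} ker (D ^ n)` is the generalized kernel of `D`, then `K` is graded,
`A` preserves `K`, and the supertrace of `A` on `K` equals the supertrace of `A` on `V`. -/
theorem supertrace_localizes_to_generalized_kernel
    {V : Type*} [AddCommGroup V] [Module ℂ V] [FiniteDimensional ℂ V]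
    (p q : Submodule ℂ V) (hpq : IsCompl p q)
    (D A : V →ₗ[ℂ] V)
    (hD₁ : ∀ v ∈ p, D v ∈ q) (hD₂ : ∀ v ∈ q, D v ∈ p)
    (hA₁ : ∀ v ∈ p, A v ∈ p) (hA₂ : ∀ v ∈ q, A v ∈ q)
    (hcomm : A ∘ₗ D = D ∘ₗ A) :
    (⨆ n : ℕ, LinearMap.ker (D ^ (n + 1)))
        = ((⨆ n : ℕ, LinearMap.ker (D ^ (n + 1))) ⊓ p)
            ⊔ ((⨆ n : ℕ, LinearMap.ker (D ^ (n + 1))) ⊓ q) ∧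
    (∀ v ∈ (⨆ n : ℕ, LinearMap.ker (D ^ (n + 1))),
        A v ∈ (⨆ n : ℕ, LinearMap.ker (D ^ (n + 1)))) ∧
    ∀ (h₁ : ∀ v ∈ (⨆ n : ℕ, LinearMap.ker (D ^ (n + 1))) ⊓ p,
        A v ∈ (⨆ n : ℕ, LinearMap.ker (D ^ (n + 1))) ⊓ p)
      (h₂ : ∀ v ∈ (⨆ n : ℕ, LinearMap.ker (D ^ (n + 1))) ⊓ q,
        A v ∈ (⨆ n : ℕ, LinearMap.ker (D ^ (n + 1))) ⊓ q),
      LinearMap.trace ℂ ↥((⨆ n : ℕ, LinearMap.ker (D ^ (n + 1))) ⊓ p) (A.restrict h₁)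
          - LinearMap.trace ℂ ↥((⨆ n : ℕ, LinearMap.ker (D ^ (n + 1))) ⊓ q) (A.restrict h₂)
        = LinearMap.trace ℂ ↥p (A.restrict hA₁) - LinearMap.trace ℂ ↥q (A.restrict hA₂) := by
  obtain ⟨m, hKer, hcompl⟩ := D.exists_iSup_ker_pow_succ_eq_ker_sq_pow
  have hDp : ∀ v ∈ p, ((D ^ 2) ^ (m + 1)) v ∈ p := Module.End.pow_apply_mem_of_forall_mem _
    fun v hv => by simpa [pow_two] using hD₂ _ (hD₁ v hv)
  have hDq : ∀ v ∈ q, ((D ^ 2) ^ (m + 1)) v ∈ q := Module.End.pow_apply_mem_of_forall_mem _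
    fun v hv => by simpa [pow_two] using hD₁ _ (hD₂ v hv)
  have hAE : Commute A ((D ^ 2) ^ (m + 1)) :=
    ((show Commute A D from hcomm).pow_right 2).pow_right (m + 1)
  have hDE : Commute D ((D ^ 2) ^ (m + 1)) := ((Commute.refl D).pow_right 2).pow_right (m + 1)
  have hDK : LinearMap.ker D ≤ LinearMap.ker ((D ^ 2) ^ (m + 1)) := by
    have h := le_iSup (fun n => LinearMap.ker (D ^ (n + 1))) 0
    rwa [hKer, zero_add, pow_one] at h
  rw [hKer]
  generalize (D ^ 2) ^ (m + 1) = E at *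
  have hK := LinearMap.ker_eq_inf_sup_inf_of_isCompl hpq hDp hDq
  have hR := LinearMap.range_eq_inf_sup_inf_of_isCompl hpq hDp hDq
  have hrange {f : V →ₗ[ℂ] V} (hf : Commute f E) :
      ∀ v ∈ LinearMap.range E, f v ∈ LinearMap.range E := by
    rintro _ ⟨x, rfl⟩
    exact ⟨f x, (LinearMap.congr_fun hf x).symm⟩
  refine ⟨hK, fun v hv => ?_, fun h₁ h₂ => ?_⟩
  · have h : A (E v) = E (A v) := LinearMap.congr_fun hAE v
    rw [LinearMap.mem_ker] at hv ⊢
    rw [← h, hv, map_zero]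
  · have hRp : ∀ v ∈ LinearMap.range E ⊓ p, A v ∈ LinearMap.range E ⊓ p :=
      fun v hv => ⟨hrange hAE v hv.1, hA₁ v hv.2⟩
    have hRq : ∀ v ∈ LinearMap.range E ⊓ q, A v ∈ LinearMap.range E ⊓ q :=
      fun v hv => ⟨hrange hAE v hv.1, hA₂ v hv.2⟩
    have hdisj (s : Submodule ℂ V) : Disjoint (LinearMap.range E ⊓ s) (LinearMap.ker D) :=
      hcompl.disjoint.symm.mono inf_le_left hDK
    rw [LinearMap.trace_restrict_eq_add_of_disjoint_of_sup_eq
        (hcompl.disjoint.mono inf_le_left inf_le_left)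
        (LinearMap.sup_inf_eq_of_graded hpq.disjoint hcompl.sup_eq_top hK hR) A h₁ hRp hA₁,
      LinearMap.trace_restrict_eq_add_of_disjoint_of_sup_eq
        (hcompl.disjoint.mono inf_le_left inf_le_left)
        (LinearMap.sup_inf_eq_of_graded hpq.disjoint.symm hcompl.sup_eq_top
          (hK.trans (sup_comm _ _)) (hR.trans (sup_comm _ _))) A h₂ hRq hA₂,
      LinearMap.trace_restrict_eq_of_commute_of_mapsTo
        (a := LinearMap.range E ⊓ p) (b := LinearMap.range E ⊓ q) hcomm
        (fun v hv => ⟨hrange hDE v hv.1, hD₁ v hv.2⟩)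
        (fun v hv => ⟨hrange hDE v hv.1, hD₂ v hv.2⟩) (hdisj p) (hdisj q) hRp hRq]
    ring
end

section
/- Let W be an n-dimensional complex vector space, u an endomorphism of W, and let v be the endomorphism of V = W ⊕ ℂ acting as u on W and as the identity on the summand ℂ. Then Σ_{i=1}^{n+1} (−1)^{i−1} · i · Tr(Λ^i v) = Σ_{j=0}^{n} (−1)^j · Tr(Λ^j u), where Λ^k f denotes the endomorphism induced by f on the k-th exterior power. -/
open ExteriorAlgebra

/-- The `i`-th exterior power of a finite module is a finite module. -/
instance exteriorPower_moduleFinite {R M : Type*} [CommRing R] [AddCommGroup M]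
    [Module R M] [Module.Finite R M] (i : ℕ) : Module.Finite R (⋀[R]^i M) := by
  rw [Module.Finite.iff_fg]
  have h : (LinearMap.range (ι R (M := M))).FG := by
    rw [← Submodule.map_top]
    exact (Module.finite_def.mp ‹Module.Finite R M›).map (ι R)
  exact Submodule.FG.pow h i

/-- The algebra morphism of exterior algebras induced by an endomorphism maps the `i`-th
exterior power into itself. -/
theorem exteriorAlgebra_map_mem_exteriorPower {R M : Type*} [CommRing R] [AddCommGroup M]
    [Module R M] (i : ℕ) (f : M →ₗ[R] M) :
    ∀ x ∈ ⋀[R]^i M, ExteriorAlgebra.map f x ∈ ⋀[R]^i M := by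
  intro x hx
  have h1 : ExteriorAlgebra.map f x ∈
      (Submodule.map (ExteriorAlgebra.map f).toLinearMap
        (LinearMap.range (ι R (M := M)))) ^ i := by
    rw [← Submodule.map_pow]
    exact Submodule.mem_map_of_mem hx
  have h2 : Submodule.map (ExteriorAlgebra.map f).toLinearMap
      (LinearMap.range (ι R (M := M))) ≤ LinearMap.range (ι R (M := M)) := by
    rw [ι_range_map_map]
    exact LinearMap.map_le_range
  exact pow_le_pow_left' h2 i h1

/-- The endomorphism induced on the `i`-th exterior power by an endomorphism `f`. -/
noncomputable def exteriorPowerMap {R M : Type*} [CommRing R] [AddCommGroup M]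
    [Module R M] (i : ℕ) (f : M →ₗ[R] M) : ⋀[R]^i M →ₗ[R] ⋀[R]^i M :=
  (ExteriorAlgebra.map f).toLinearMap.restrict (exteriorAlgebra_map_mem_exteriorPower i f)

open Polynomial in
/-- The trace of the endomorphism induced by `f` on the `k`-th exterior power is the `k`-th
coefficient of `det (1 + X • A)`, where `A` is the matrix of `f` in any basis. -/
theorem trace_exteriorPowerMap_eq_coeff_det {R M ι : Type*} [CommRing R] [AddCommGroup M]
    [Module R M] [Fintype ι] [DecidableEq ι] (b : Module.Basis ι R M) (k : ℕ) (f : M →ₗ[R] M) :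
    LinearMap.trace R (⋀[R]^k M) (exteriorPowerMap k f) =
      (Matrix.det (1 + (X : R[X]) • (LinearMap.toMatrix b b f).map C)).coeff k := by
  classical
  let order : LinearOrder ι := linearOrderOfSTO WellOrderingRel
  rw [Matrix.coeff_det_one_add_X_smul_eq_sum_minors,
    LinearMap.trace_eq_matrix_trace R (b.exteriorPower k), Matrix.trace,
    Finset.sum_subtype (F := inferInstanceAs (Fintype (Set.powersetCard ι k))) _
      (p := (· ∈ Set.powersetCard ι k)) (by simp)]
  symm
  refine Finset.sum_congr rfl fun s _ => ?_
  have hmap : exteriorPowerMap k f (b.exteriorPower k s) =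
      exteriorPower.ιMulti R k (f ∘ b ∘ Set.powersetCard.ofFinEmbEquiv.symm s) := by
    rw [exteriorPower.basis_apply]
    exact Subtype.ext (ExteriorAlgebra.map_apply_ιMulti f _)
  rw [Matrix.diag_apply, LinearMap.toMatrix_apply, hmap, exteriorPower.basis_repr_apply,
    exteriorPower.ιMultiDual_apply_ιMulti, ← Matrix.det_transpose,
    ← Matrix.det_submatrix_equiv_self (s.1.orderIsoOfFin (Set.powersetCard.card_eq s)).toEquiv]
  congr 1
  ext i j
  simp [LinearMap.toMatrix_apply, Set.powersetCard.ofFinEmbEquiv_symm_apply]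

open Polynomial in
/-- Adding an identity summand of rank one multiplies `det (1 + X • A)` by `1 + X`. -/
theorem det_one_add_X_smul_toMatrix_prodMap_id {R M ι : Type*} [CommRing R] [AddCommGroup M]
    [Module R M] [Fintype ι] [DecidableEq ι] (b : Module.Basis ι R M) (f : M →ₗ[R] M) :
    Matrix.det (1 + (X : R[X]) • (LinearMap.toMatrix (b.prod (Module.Basis.singleton Unit R))
        (b.prod (Module.Basis.singleton Unit R)) (f.prodMap LinearMap.id)).map C) =
      Matrix.det (1 + (X : R[X]) • (LinearMap.toMatrix b b f).map C) * (1 + X) := by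
  rw [LinearMap.toMatrix_prodMap, LinearMap.toMatrix_id, Matrix.fromBlocks_map,
    Matrix.fromBlocks_smul, ← Matrix.fromBlocks_one, Matrix.fromBlocks_add]
  simp

open Polynomial in
/-- Leibniz rule at `-1` for `p * (1 + X)`, written out in coefficients. -/
theorem sum_derived_coeff_mul_one_add_X {R : Type*} [CommRing R] {p : R[X]} {n : ℕ}
    (hp : p.natDegree ≤ n) :
    ∑ i ∈ Finset.Icc 1 (n + 1), (-1 : R) ^ (i - 1) * (i : R) * (p * (1 + X)).coeff i =
      ∑ j ∈ Finset.range (n + 1), (-1 : R) ^ j * p.coeff j := by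
  have hq : (p * (1 + X)).natDegree ≤ n + 1 :=
    natDegree_mul_le_of_le hp (by compute_degree)
  have hd : (derivative (p * (1 + X))).natDegree < n + 1 :=
    Nat.lt_succ_of_le ((natDegree_derivative_le _).trans (by omega))
  have key : (derivative (p * (1 + X))).eval (-1) = p.eval (-1) := by simp
  rw [eval_eq_sum_range' hd, eval_eq_sum_range' (Nat.lt_succ_of_le hp)] at key
  rw [← Finset.Ico_add_one_right_eq_Icc, Finset.sum_Ico_eq_sum_range]
  calc
    _ = ∑ i ∈ Finset.range (n + 1), (derivative (p * (1 + X))).coeff i * (-1) ^ i := by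
      refine Finset.sum_congr rfl fun i _ => ?_
      rw [coeff_derivative, add_comm 1 i, Nat.add_sub_cancel]
      push_cast
      ring
    _ = _ := key.trans (Finset.sum_congr rfl fun i _ => mul_comm _ _)

/-- For `u` an endomorphism of an `n`-dimensional complex vector space `W`, and `v = u ⊕ 1`
the endomorphism of `W ⊕ ℂ` acting as `u` on `W` and as the identity on `ℂ`:
`Σ_{i=1}^{n+1} (-1)^{i-1} i Tr(Λ^i v) = Σ_{j=0}^{n} (-1)^j Tr(Λ^j u)`. -/
theorem derived_exterior_trace_sum_eq
    {W : Type*} [AddCommGroup W] [Module ℂ W] [FiniteDimensional ℂ W]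
    {n : ℕ} (hn : Module.finrank ℂ W = n)
    (u : W →ₗ[ℂ] W) (v : (W × ℂ) →ₗ[ℂ] (W × ℂ))
    (hv : v = u.prodMap (LinearMap.id : ℂ →ₗ[ℂ] ℂ)) :
    ∑ i ∈ Finset.Icc 1 (n + 1),
        (-1 : ℂ) ^ (i - 1) * (i : ℂ) * LinearMap.trace ℂ ↥(⋀[ℂ]^i (W × ℂ)) (exteriorPowerMap i v)
      = ∑ j ∈ Finset.range (n + 1),
        (-1 : ℂ) ^ j * LinearMap.trace ℂ ↥(⋀[ℂ]^j W) (exteriorPowerMap j u) := by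
  subst hv
  let b := Module.finBasisOfFinrankEq ℂ W hn
  simp_rw [trace_exteriorPowerMap_eq_coeff_det b,
    trace_exteriorPowerMap_eq_coeff_det (b.prod (Module.Basis.singleton Unit ℂ)),
    det_one_add_X_smul_toMatrix_prodMap_id b u]
  refine sum_derived_coeff_mul_one_add_X ?_
  have h := Polynomial.natDegree_det_X_add_C_le (LinearMap.toMatrix b b u) 1
  rw [add_comm]
  simpa using h
end
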